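/- arXiv:1111.6452 — 3 statements merged into one kernel-verified Lean document; each statement's English description precedes it below -/
import Mathlib

section
/- Let U, V, W be finite-dimensional representations of a finite quiver Q over the finite field F_q. Then F_{UV}^W = (|Ext_Q(U,V)_W| / |Hom_Q(U,V)|) * (a_W / (a_U * a_V)). -/
/- Common setup: finite quivers, finite-dimensional representations over a
finite field, subrepresentations, quotients, Hall numbers, quiver
Grassmannians and flags, extensions, and the (completed) Hall algebra,
following J. Fei, "Counting using Hall algebras I. Quivers". -/

open scoped BigOperators

attribute [local instance] Classical.propDecidable

namespace HallPaper

/-- A finite quiver: finitely many vertices and arrows. -/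
structure FinQuiver where
  V : Type
  A : Type
  [fV : Fintype V]
  [fA : Fintype A]
  src : A → V
  tgt : A → V

attribute [instance] FinQuiver.fV FinQuiver.fA

/-- The additive Euler form `⟨α,β⟩_a = ∑_v α(v)β(v) - ∑_a α(ta)β(ha)`. -/
def eulerForm (Q : FinQuiver) (α β : Q.V → ℤ) : ℤ :=
  (∑ v, α v * β v) - ∑ a, α (Q.src a) * β (Q.tgt a)

/-- The additive Euler form on dimension vectors. -/
def eulerFormN (Q : FinQuiver) (α β : Q.V → ℕ) : ℤ :=
  eulerForm Q (fun v => (α v : ℤ)) (fun v => (β v : ℤ))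

/-- `Q` has no oriented cycles. -/
def NoCycles (Q : FinQuiver) : Prop :=
  ¬ ∃ (n : ℕ) (c : Fin (n + 1) → Q.A),
      (∀ i : Fin n, Q.tgt (c i.castSucc) = Q.src (c i.succ)) ∧
      Q.tgt (c (Fin.last n)) = Q.src (c 0)

/-- A finite-dimensional representation of a finite quiver `Q` over `k`. -/
structure QRep (Q : FinQuiver) (k : Type) [Field k] where
  space : Q.V → Type
  [acg : ∀ v, AddCommGroup (space v)]
  [mod : ∀ v, Module k (space v)]
  [fd : ∀ v, FiniteDimensional k (space v)]
  map : ∀ a : Q.A, space (Q.src a) →ₗ[k] space (Q.tgt a)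

attribute [instance] QRep.acg QRep.mod QRep.fd

namespace QRep

variable {Q : FinQuiver} {k : Type} [Field k]

/-- The dimension vector of a representation. -/
noncomputable def dimVec (M : QRep Q k) : Q.V → ℕ :=
  fun v => Module.finrank k (M.space v)

/-- A morphism of quiver representations. -/
structure Hom (M N : QRep Q k) where
  app : ∀ v, M.space v →ₗ[k] N.space v
  comm : ∀ (a : Q.A) (x : M.space (Q.src a)),
    app (Q.tgt a) (M.map a x) = N.map a (app (Q.src a) x)

/-- The identity morphism. -/
def Hom.id (M : QRep Q k) : Hom M M :=
  ⟨fun _ => LinearMap.id, fun _ _ => rfl⟩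

/-- Composition of morphisms. -/
def Hom.comp {M N P : QRep Q k} (g : Hom N P) (f : Hom M N) : Hom M P :=
  ⟨fun v => (g.app v).comp (f.app v), fun a x => by
    simp only [LinearMap.comp_apply, f.comm, g.comm]⟩

/-- An isomorphism of quiver representations. -/
structure Iso (M N : QRep Q k) where
  app : ∀ v, M.space v ≃ₗ[k] N.space v
  comm : ∀ (a : Q.A) (x : M.space (Q.src a)),
    app (Q.tgt a) (M.map a x) = N.map a (app (Q.src a) x)

/-- Two representations are isomorphic. -/
def IsIsomorphic (M N : QRep Q k) : Prop := Nonempty (Iso M N)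

/-- `a_M`, the number of automorphisms of `M`. -/
noncomputable def autCard (M : QRep Q k) : ℕ := Nat.card (Iso M M)

/-- `|Hom_Q(M,N)|`. -/
noncomputable def homCard (M N : QRep Q k) : ℕ := Nat.card (Hom M N)

/-- A subrepresentation: a family of subspaces stable under all arrow maps. -/
structure SubRep (M : QRep Q k) where
  sub : ∀ v, Submodule k (M.space v)
  stable : ∀ (a : Q.A) (x : M.space (Q.src a)),
    x ∈ sub (Q.src a) → M.map a x ∈ sub (Q.tgt a)

namespace SubRep

variable {M : QRep Q k}

/-- A subrepresentation as a representation in its own right. -/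
def toRep (L : SubRep M) : QRep Q k where
  space := fun v => L.sub v
  acg := fun _ => inferInstance
  mod := fun _ => inferInstance
  fd := fun _ => inferInstance
  map := fun a => (M.map a).restrict (fun x hx => L.stable a x hx)

/-- The quotient representation `M/L`. -/
def quotRep (L : SubRep M) : QRep Q k where
  space := fun v => M.space v ⧸ L.sub v
  acg := fun _ => inferInstance
  mod := fun _ => inferInstance
  fd := fun _ => inferInstance
  map := fun a => Submodule.mapQ _ _ (M.map a) (fun x hx => L.stable a x hx)

/-- The dimension vector of a subrepresentation. -/
noncomputable def dim (L : SubRep M) : Q.V → ℕ :=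
  fun v => Module.finrank k (L.sub v)

/-- The zero subrepresentation predicate. -/
def IsZero (L : SubRep M) : Prop := ∀ v, L.sub v = ⊥

/-- The full subrepresentation predicate. -/
def IsFull (L : SubRep M) : Prop := ∀ v, L.sub v = ⊤

/-- Containment of subrepresentations. -/
def le (L L' : SubRep M) : Prop := ∀ v, L.sub v ≤ L'.sub v

/-- The subquotient `L'/L` of two nested subrepresentations. -/
def subquot (L L' : SubRep M) (h : L.le L') : QRep Q k where
  space := fun v => (L'.sub v) ⧸ ((L.sub v).comap (L'.sub v).subtype)
  acg := fun _ => inferInstance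
  mod := fun _ => inferInstance
  fd := fun _ => inferInstance
  map := fun a =>
    Submodule.mapQ _ _ ((M.map a).restrict (fun x hx => L'.stable a x hx))
      (fun x hx => by
        have hx' : (x : M.space (Q.src a)) ∈ L.sub (Q.src a) := hx
        have := L.stable a x hx'
        simpa [Submodule.mem_comap] using this)

end SubRep

/-- The number of points of the quiver Grassmannian `Gr_γ(M)`. -/
noncomputable def grCard (γ : Q.V → ℕ) (M : QRep Q k) : ℕ :=
  Nat.card {L : SubRep M // L.dim = γ}

/-- The Hall number `F_{UV}^W`: the number of subrepresentations `L ⊆ W`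
with `L ≅ V` and `W/L ≅ U`. -/
noncomputable def hallNum (U V W : QRep Q k) : ℕ :=
  Nat.card {L : SubRep W // IsIsomorphic L.toRep V ∧ IsIsomorphic L.quotRep U}

/-- The number of points of the quiver flag variety `Fl_{α_t ⋯ α_1}(M)`;
here `α i` is the dimension vector of the subquotient `L_{i+1}/L_i`. -/
noncomputable def flCard {t : ℕ} (α : Fin t → (Q.V → ℕ)) (M : QRep Q k) : ℕ :=
  Nat.card {L : Fin (t + 1) → SubRep M //
    (L 0).IsZero ∧ (L (Fin.last t)).IsFull ∧
    (∀ i : Fin t, (L i.castSucc).le (L i.succ)) ∧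
    (∀ i : Fin t, ∀ v, (L i.succ).dim v = (L i.castSucc).dim v + α i v)}

/-- Cochains: the space whose quotient by coboundaries is `Ext¹_Q(U,V)`. -/
abbrev Cochain (U V : QRep Q k) :=
  ∀ a : Q.A, U.space (Q.src a) →ₗ[k] V.space (Q.tgt a)

/-- The coboundary of a family of linear maps. -/
def coboundary {U V : QRep Q k} (f : ∀ v, U.space v →ₗ[k] V.space v) :
    Cochain U V :=
  fun a => (V.map a).comp (f (Q.src a)) - (f (Q.tgt a)).comp (U.map a)

/-- Two cochains define the same class in `Ext¹_Q(U,V)`. -/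
def extRel (U V : QRep Q k) (z z' : Cochain U V) : Prop :=
  ∃ f, z' = z + coboundary f

/-- `|Ext¹_Q(U,V)|`. -/
noncomputable def ext1Card (U V : QRep Q k) : ℕ := Nat.card (Quot (extRel U V))

/-- The middle term of the extension of `U` by `V` defined by a cochain. -/
def middle {U V : QRep Q k} (z : Cochain U V) : QRep Q k where
  space := fun v => V.space v × U.space v
  acg := fun _ => inferInstance
  mod := fun _ => inferInstance
  fd := fun _ => inferInstance
  map := fun a =>
    LinearMap.prod
      ((V.map a).comp (LinearMap.fst k _ _) + (z a).comp (LinearMap.snd k _ _))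
      ((U.map a).comp (LinearMap.snd k _ _))

/-- `|Ext_Q(U,V)_W|`: the number of classes in `Ext¹_Q(U,V)` of extensions
with middle term isomorphic to `W`. -/
noncomputable def extWCard (U V W : QRep Q k) : ℕ :=
  Nat.card {e : Quot (extRel U V) //
    ∃ z : Cochain U V, Quot.mk _ z = e ∧ IsIsomorphic (middle z) W}

/-- `T` is rigid, i.e. `Ext¹_Q(T,T) = 0`. -/
def IsRigid (T : QRep Q k) : Prop :=
  ∀ z : Cochain T T, ∃ f, z = coboundary f

/-- Direct sum of two representations. -/
def dsum (M N : QRep Q k) : QRep Q k where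
  space := fun v => M.space v × N.space v
  acg := fun _ => inferInstance
  mod := fun _ => inferInstance
  fd := fun _ => inferInstance
  map := fun a => (M.map a).prodMap (N.map a)

/-- Finite direct sums of representations. -/
def dsumFin {ι : Type} [Fintype ι] (f : ι → QRep Q k) : QRep Q k where
  space := fun v => ∀ i, (f i).space v
  acg := fun _ => inferInstance
  mod := fun _ => inferInstance
  fd := fun _ => inferInstance
  map := fun a => LinearMap.pi (fun i => ((f i).map a).comp (LinearMap.proj i))

/-- A simple representation. -/
def IsSimple (M : QRep Q k) : Prop :=
  M.dimVec ≠ 0 ∧ ∀ L : SubRep M, L.IsZero ∨ L.IsFull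

/-- An indecomposable representation. -/
def Indecomposable (M : QRep Q k) : Prop :=
  M.dimVec ≠ 0 ∧
    ∀ A B : QRep Q k, IsIsomorphic M (dsum A B) → A.dimVec = 0 ∨ B.dimVec = 0

end QRep

open QRep

/-- The affine space of `α`-dimensional representations: one matrix per arrow. -/
def StdRep (Q : FinQuiver) (k : Type) [Field k] (α : Q.V → ℕ) :=
  ∀ a : Q.A, Matrix (Fin (α (Q.tgt a))) (Fin (α (Q.src a))) k

instance (Q : FinQuiver) (k : Type) [Field k] [Fintype k] (α : Q.V → ℕ) :
    Finite (StdRep Q k α) := by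
  unfold StdRep; infer_instance

/-- A point of `Rep_α(Q)` as an abstract representation. -/
def StdRep.toQRep {Q : FinQuiver} {k : Type} [Field k] {α : Q.V → ℕ}
    (W : StdRep Q k α) : QRep Q k where
  space := fun v => Fin (α v) → k
  acg := fun _ => inferInstance
  mod := fun _ => inferInstance
  fd := fun _ => inferInstance
  map := fun a => Matrix.mulVecLin (W a)

/-- Isomorphism relation on `α`-dimensional representations. -/
def isoRel (Q : FinQuiver) (k : Type) [Field k] (α : Q.V → ℕ)
    (W W' : StdRep Q k α) : Prop :=
  IsIsomorphic W.toQRep W'.toQRep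

/-- Isomorphism classes of `α`-dimensional representations of `Q` over `k`. -/
def IsoClass (Q : FinQuiver) (k : Type) [Field k] (α : Q.V → ℕ) :=
  Quot (isoRel Q k α)

/-- A representative representation of an isomorphism class. -/
noncomputable def IsoClass.rep {Q : FinQuiver} {k : Type} [Field k]
    {α : Q.V → ℕ} (c : IsoClass Q k α) : QRep Q k :=
  (Quot.out c).toQRep

/-- Isomorphism classes of representations of all dimension vectors. -/
abbrev TotalClass (Q : FinQuiver) (k : Type) [Field k] :=
  Σ α : Q.V → ℕ, IsoClass Q k α

/-- A representative of a class in `TotalClass`. -/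
noncomputable def TotalClass.rep {Q : FinQuiver} {k : Type} [Field k]
    (c : TotalClass Q k) : QRep Q k :=
  c.2.rep

section Counting

variable (Q : FinQuiver) (k : Type) [Field k] [Fintype k]

/-- `|Rep_α(Q)(F_q)|`. -/
noncomputable def repCard (α : Q.V → ℕ) : ℕ := Nat.card (StdRep Q k α)

/-- `|GL_α(F_q)|`. -/
noncomputable def glCard (α : Q.V → ℕ) : ℕ :=
  Nat.card (∀ v : Q.V, Matrix.GeneralLinearGroup (Fin (α v)) k)

/-- `r_α(q) = |Rep_α(Q)| / |GL_α|`. -/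
noncomputable def rFun (α : Q.V → ℕ) : ℚ :=
  (repCard Q k α : ℚ) / (glCard Q k α : ℚ)

end Counting

section Slope

variable {Q : FinQuiver}

/-- The value of a weight (`ℤ`-linear functional) on a dimension vector. -/
def wt (σ : Q.V → ℤ) (α : Q.V → ℕ) : ℤ := ∑ v, σ v * α v

/-- The slope `μ(α) = σ(α)/θ(α)`. -/
noncomputable def slope (σ θ : Q.V → ℤ) (α : Q.V → ℕ) : ℚ :=
  (wt σ α : ℚ) / (wt θ α : ℚ)

/-- `θ` is positive on all nonzero dimension vectors (so `σ/θ` is a slope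
function). -/
def SlopeOK (θ : Q.V → ℤ) : Prop :=
  ∀ α : Q.V → ℕ, α ≠ 0 → 0 < wt θ α

variable {k : Type} [Field k]

/-- `μ`-semistability. -/
def IsSemistable (σ θ : Q.V → ℤ) (M : QRep Q k) : Prop :=
  ∀ L : SubRep M, ¬ L.IsZero → ¬ L.IsFull →
    slope σ θ L.dim ≤ slope σ θ M.dimVec

/-- `μ`-stability. -/
def IsStable (σ θ : Q.V → ℤ) (M : QRep Q k) : Prop :=
  ∀ L : SubRep M, ¬ L.IsZero → ¬ L.IsFull →
    slope σ θ L.dim < slope σ θ M.dimVec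

/-- `μ` is coprime to `α`: `μ(γ) ≠ μ(α)` for all `0 < γ < α`. -/
def Coprime (σ θ : Q.V → ℤ) (α : Q.V → ℕ) : Prop :=
  ∀ γ : Q.V → ℕ, γ ≠ 0 → γ ≤ α → γ ≠ α → slope σ θ γ ≠ slope σ θ α

end Slope

section Decomp

variable {Q : FinQuiver}

/-- Ordered decompositions `α = α_1 + ⋯ + α_s` into nonzero dimension vectors
with strictly increasing slopes (Harder–Narasimhan type). -/
structure HNDecomp (σ θ : Q.V → ℤ) (α : Q.V → ℕ) where
  s : ℕ
  pos : 0 < s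
  d : Fin s → (Q.V → ℕ)
  nonzero : ∀ i, d i ≠ 0
  total : ∑ i, d i = α
  incr : ∀ i j : Fin s, i < j → slope σ θ (d i) < slope σ θ (d j)

/-- Ordered decompositions `α = α_1 + ⋯ + α_s` into nonzero dimension vectors
with `μ(α_1 + ⋯ + α_k) < μ(α)` for all `k < s`. -/
structure StarDecomp (σ θ : Q.V → ℤ) (α : Q.V → ℕ) where
  s : ℕ
  pos : 0 < s
  d : Fin s → (Q.V → ℕ)
  nonzero : ∀ i, d i ≠ 0
  total : ∑ i, d i = α
  partial_lt : ∀ kk : Fin s, (kk : ℕ) + 1 < s →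
    slope σ θ (∑ i ∈ Finset.Iic kk, d i) < slope σ θ α

end Decomp

section Hall

variable (Q : FinQuiver) (k : Type) [Field k]

/-- The underlying space of the completed Hall algebra: formal (possibly
infinite) linear combinations of isomorphism classes. -/
abbrev HallAlg := TotalClass Q k → ℚ

/-- The Hall product `[U][V] = ∑_{[W]} F_{UV}^W [W]`, written on coefficient
functions. -/
noncomputable def hallMul (x y : HallAlg Q k) : HallAlg Q k :=
  fun W => ∑ᶠ (U : TotalClass Q k) (V : TotalClass Q k),
    x U * y V * (hallNum U.rep V.rep W.rep : ℚ)

/-- The unit `[0]` of the Hall algebra. -/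
noncomputable def hallOne : HallAlg Q k :=
  fun c => if c.1 = 0 then 1 else 0

/-- Iterated Hall product of a list. -/
noncomputable def hallProd (l : List (HallAlg Q k)) : HallAlg Q k :=
  l.foldr (hallMul Q k) (hallOne Q k)

/-- The twisted Hall product `[U][V] = ∑_{[W]} q^{⟨dim U, dim V⟩} F_{UV}^W [W]`. -/
noncomputable def hallMulTw [Fintype k] (x y : HallAlg Q k) : HallAlg Q k :=
  fun W => ∑ᶠ (U : TotalClass Q k) (V : TotalClass Q k),
    x U * y V * ((Fintype.card k : ℚ) ^ eulerFormN Q U.rep.dimVec V.rep.dimVec) *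
      (hallNum U.rep V.rep W.rep : ℚ)

/-- `χ_α`, the sum of all `[M]` with `dim M = α`. -/
noncomputable def chiElt (α : Q.V → ℕ) : HallAlg Q k :=
  fun c => if c.1 = α then 1 else 0

/-- `χ_α^{ss}`, the sum of all semistable `[M]` with `dim M = α`. -/
noncomputable def chiSS (σ θ : Q.V → ℤ) (α : Q.V → ℕ) : HallAlg Q k :=
  fun c => if c.1 = α ∧ IsSemistable σ θ c.rep then 1 else 0

/-- The completed quantum polynomial algebra `P_{⟨Q⟩}` (coefficient functions
on monomials `t^α`). -/
abbrev QPoly := (Q.V → ℕ) → ℚ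

/-- Multiplication `t^α t^β = q^{-⟨α,β⟩_a} t^{α+β}` of `P_{⟨Q⟩}`. -/
noncomputable def qpolyMul [Fintype k] (x y : QPoly Q) : QPoly Q :=
  fun α => ∑ᶠ (β : Q.V → ℕ) (γ : Q.V → ℕ),
    if β + γ = α then
      ((Fintype.card k : ℚ) ^ (-(eulerFormN Q β γ))) * x β * y γ
    else 0

/-- The unit of `P_{⟨Q⟩}`. -/
noncomputable def qpolyOne : QPoly Q :=
  fun α => if α = 0 then 1 else 0

/-- The integration map `∫ : H(Q) → P_{⟨Q⟩}`, `[M] ↦ a_M⁻¹ t^{dim M}`. -/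
noncomputable def intChar (x : HallAlg Q k) : QPoly Q :=
  fun α => ∑ᶠ c : IsoClass Q k α, x ⟨α, c⟩ / (autCard (IsoClass.rep c) : ℚ)

end Hall

section Chains

variable {Q : FinQuiver} {k : Type} [Field k]

/-- The number of strict chains `0 = W_0 < W_1 < ⋯ < W_i = W` of
subrepresentations. -/
noncomputable def chainCount (M : QRep Q k) (i : ℕ) : ℕ :=
  Nat.card {L : Fin (i + 1) → SubRep M //
    (L 0).IsZero ∧ (L (Fin.last i)).IsFull ∧
    ∀ j : Fin i, (L j.castSucc).le (L j.succ) ∧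
      (L j.castSucc).sub ≠ (L j.succ).sub}

/-- `F_W = ∑_i (-1)^i F_i(W)`, the alternating sum of numbers of strict
chains of subrepresentations. -/
noncomputable def FW (M : QRep Q k) : ℚ :=
  ∑ᶠ i : ℕ, (-1 : ℚ) ^ i * (chainCount M i : ℚ)

end Chains

section Riedtmann

variable {Q : FinQuiver} {k : Type} [Field k]

/-- Counting through a map whose fibers are torsors. -/
theorem card_torsor {X Y T : Type*} (F : X → Y) (hF : Function.Surjective F)
    (act : X → T → X) (hinj : ∀ x, Function.Injective (act x))
    (hfib : ∀ x x', F x' = F x ↔ ∃ t, act x t = x') :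
    Nat.card X = Nat.card Y * Nat.card T := by
  have h : ∀ y, Nonempty (T ≃ {x // F x = y}) := by
    intro y
    obtain ⟨x, rfl⟩ := hF y
    refine ⟨Equiv.ofBijective (fun t => ⟨act x t, (hfib x _).2 ⟨t, rfl⟩⟩) ⟨?_, ?_⟩⟩
    · intro t t' h
      exact hinj x (congrArg Subtype.val h)
    · rintro ⟨x', hx'⟩
      obtain ⟨t, ht⟩ := (hfib x x').1 hx'
      exact ⟨t, Subtype.ext ht⟩
  rw [← Nat.card_prod, ← Nat.card_congr (Equiv.sigmaFiberEquiv F)]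
  refine Nat.card_congr ?_
  exact (Equiv.sigmaCongrRight (fun y => (h y).some.symm)).trans (Equiv.sigmaEquivProd _ _)

theorem Hom.ext_app {M N : QRep Q k} {f g : Hom M N}
    (h : ∀ v x, f.app v x = g.app v x) : f = g := by
  obtain ⟨f, _⟩ := f
  obtain ⟨g, _⟩ := g
  have : f = g := funext fun v => LinearMap.ext (h v)
  subst this; rfl

theorem Iso.ext_app {M N : QRep Q k} {f g : Iso M N}
    (h : ∀ v x, f.app v x = g.app v x) : f = g := by
  obtain ⟨f, _⟩ := f
  obtain ⟨g, _⟩ := g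
  have : f = g := funext fun v => LinearEquiv.ext (h v)
  subst this; rfl

/-- The inverse isomorphism. -/
def isoSymm {M N : QRep Q k} (f : Iso M N) : Iso N M :=
  ⟨fun v => (f.app v).symm, fun a x => by
    rw [LinearEquiv.symm_apply_eq, f.comm, LinearEquiv.apply_symm_apply]⟩

/-- Composition of isomorphisms. -/
def isoTrans {M N P : QRep Q k} (f : Iso M N) (g : Iso N P) : Iso M P :=
  ⟨fun v => (f.app v).trans (g.app v), fun a x => by
    simp only [LinearEquiv.trans_apply, f.comm, g.comm]⟩

/-- Short exact sequences `0 → V → W → U → 0`. -/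
structure SES (U V W : QRep Q k) where
  f : Hom V W
  g : Hom W U
  inj : ∀ v, Function.Injective (f.app v)
  surj : ∀ v, Function.Surjective (g.app v)
  exact : ∀ v x, g.app v x = 0 ↔ ∃ y, f.app v y = x

theorem SES.ext_app {U V W : QRep Q k} {e e' : SES U V W}
    (h : ∀ v x, e.f.app v x = e'.f.app v x) (h' : ∀ v x, e.g.app v x = e'.g.app v x) :
    e = e' := by
  obtain ⟨f, g, _, _, _⟩ := e
  obtain ⟨f', g', _, _, _⟩ := e'
  have : f = f' := Hom.ext_app h
  subst this
  have : g = g' := Hom.ext_app h'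
  subst this; rfl

/-- The image of the first map of a short exact sequence. -/
def SES.img {U V W : QRep Q k} (e : SES U V W) : SubRep W where
  sub := fun v => LinearMap.range (e.f.app v)
  stable := by
    rintro a _ ⟨y, rfl⟩
    exact ⟨V.map a y, e.f.comm a y⟩

theorem SubRep.ext_sub {M : QRep Q k} {L L' : SubRep M} (h : ∀ v, L.sub v = L'.sub v) :
    L = L' := by
  obtain ⟨s, _⟩ := L
  obtain ⟨s', _⟩ := L'
  have : s = s' := funext h
  subst this; rfl

theorem SES.img_toRep {U V W : QRep Q k} (e : SES U V W) : IsIsomorphic e.img.toRep V := by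
  refine ⟨isoSymm ⟨fun v => LinearEquiv.ofInjective (e.f.app v) (e.inj v), ?_⟩⟩
  intro a x
  exact Subtype.ext (e.f.comm a x)

theorem SES.ker_eq {U V W : QRep Q k} (e : SES U V W) (v : Q.V) :
    LinearMap.ker (e.g.app v) = e.img.sub v := by
  ext x
  exact e.exact v x

theorem SES.img_quotRep {U V W : QRep Q k} (e : SES U V W) :
    IsIsomorphic e.img.quotRep U := by
  refine ⟨⟨fun v => (Submodule.quotEquivOfEq _ _ (e.ker_eq v).symm).trans
    ((e.g.app v).quotKerEquivOfSurjective (e.surj v)), ?_⟩⟩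
  intro a x
  obtain ⟨w, rfl⟩ := Submodule.Quotient.mk_surjective _ x
  exact e.g.comm a w

theorem card_ses (U V W : QRep Q k) :
    Nat.card (SES U V W) = hallNum U V W * (autCard V * autCard U) := by
  unfold hallNum autCard
  rw [← Nat.card_prod]
  refine card_torsor (fun e => ⟨e.img, e.img_toRep, e.img_quotRep⟩) ?_
    (fun e t => ⟨⟨fun v => (e.f.app v).comp (t.1.app v).toLinearMap, ?_⟩,
      ⟨fun v => (t.2.app v).toLinearMap.comp (e.g.app v), ?_⟩, ?_, ?_, ?_⟩) ?_ ?_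
  · rintro ⟨L, ⟨p⟩, ⟨r⟩⟩
    let p' := isoSymm p
    refine ⟨⟨⟨fun v => (L.sub v).subtype.comp (p'.app v).toLinearMap, ?_⟩,
      ⟨fun v => (r.app v).toLinearMap.comp (L.sub v).mkQ, ?_⟩, ?_, ?_, ?_⟩, ?_⟩
    · intro a x
      exact congrArg Subtype.val (p'.comm a x)
    · intro a x
      exact r.comm a (Submodule.Quotient.mk x)
    · intro v
      exact Subtype.val_injective.comp (p'.app v).injective
    · intro v
      exact (r.app v).surjective.comp (Submodule.mkQ_surjective _)
    · intro v x
      have h1 : (r.app v) (Submodule.Quotient.mk x) = 0 ↔ x ∈ L.sub v :=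
        (LinearEquiv.map_eq_zero_iff (r.app v)).trans (Submodule.Quotient.mk_eq_zero _)
      refine h1.trans ⟨fun hx => ⟨p.app v ⟨x, hx⟩, ?_⟩, ?_⟩
      · exact congrArg Subtype.val ((p.app v).symm_apply_apply ⟨x, hx⟩)
      · rintro ⟨y, rfl⟩
        exact ((p'.app v) y).2
    · refine Subtype.ext (SubRep.ext_sub fun v => ?_)
      ext x
      constructor
      · rintro ⟨y, rfl⟩
        exact ((p'.app v) y).2
      · intro hx
        exact ⟨p.app v ⟨x, hx⟩, congrArg Subtype.val ((p.app v).symm_apply_apply ⟨x, hx⟩)⟩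
  · intro a x
    simp [t.1.comm, e.f.comm]
  · intro a x
    simp [t.2.comm, e.g.comm]
  · intro v
    exact (e.inj v).comp (t.1.app v).injective
  · intro v
    exact (t.2.app v).surjective.comp (e.surj v)
  · intro v x
    refine (LinearEquiv.map_eq_zero_iff (t.2.app v)).trans ((e.exact v x).trans ⟨?_, ?_⟩)
    · rintro ⟨y, rfl⟩
      exact ⟨(t.1.app v).symm y, by simp⟩
    · rintro ⟨y, rfl⟩
      exact ⟨t.1.app v y, rfl⟩
  · rintro e ⟨α, β⟩ ⟨α', β'⟩ h
    refine Prod.ext (Iso.ext_app fun v x => ?_) (Iso.ext_app fun v x => ?_)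
    · apply e.inj v
      exact congrArg (fun s : SES U V W => s.f.app v x) h
    · obtain ⟨w, rfl⟩ := e.surj v x
      exact congrArg (fun s : SES U V W => s.g.app v w) h
  · intro e e'
    constructor
    · intro h
      have hs : ∀ v, LinearMap.range (e'.f.app v) = LinearMap.range (e.f.app v) := fun v =>
        congrArg (fun L => L.1.sub v) h
      have hk : ∀ v, LinearMap.ker (e.g.app v) = LinearMap.ker (e'.g.app v) := fun v => by
        rw [e.ker_eq, e'.ker_eq]; exact (hs v).symm
      let α : ∀ v, V.space v ≃ₗ[k] V.space v := fun v =>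
        ((LinearEquiv.ofInjective _ (e'.inj v)).trans (LinearEquiv.ofEq _ _ (hs v))).trans
          (LinearEquiv.ofInjective _ (e.inj v)).symm
      have hα : ∀ v x, e.f.app v (α v x) = e'.f.app v x := fun v x => by
        have := congrArg Subtype.val ((LinearEquiv.ofInjective _ (e.inj v)).apply_symm_apply
          ((LinearEquiv.ofEq _ _ (hs v)) (LinearEquiv.ofInjective _ (e'.inj v) x)))
        exact this
      let β : ∀ v, U.space v ≃ₗ[k] U.space v := fun v =>
        (((e.g.app v).quotKerEquivOfSurjective (e.surj v)).symm.trans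
          (Submodule.quotEquivOfEq _ _ (hk v))).trans
          ((e'.g.app v).quotKerEquivOfSurjective (e'.surj v))
      have hβ : ∀ v x, β v (e.g.app v x) = e'.g.app v x := fun v x => by
        have h1 : ((e.g.app v).quotKerEquivOfSurjective (e.surj v)).symm (e.g.app v x)
            = Submodule.Quotient.mk x := by
          rw [LinearEquiv.symm_apply_eq]; rfl
        simp only [β, LinearEquiv.trans_apply, h1]
        rfl
      refine ⟨⟨⟨α, ?_⟩, ⟨β, ?_⟩⟩, SES.ext_app hα hβ⟩
      · intro a x
        apply e.inj
        rw [hα, e'.f.comm, e.f.comm, hα]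
      · intro a x
        obtain ⟨w, rfl⟩ := e.surj _ x
        rw [← e.g.comm, hβ, hβ, e'.g.comm]
    · rintro ⟨⟨α, β⟩, rfl⟩
      refine Subtype.ext (SubRep.ext_sub fun v => ?_)
      ext x
      constructor
      · rintro ⟨y, rfl⟩
        exact ⟨α.app v y, rfl⟩
      · rintro ⟨y, rfl⟩
        exact ⟨(α.app v).symm y, congrArg (e.f.app v) ((α.app v).apply_symm_apply y)⟩

/-- Cochains together with an isomorphism of the middle term with `W`. -/
structure Fr (U V W : QRep Q k) where
  z : Cochain U V
  φ : ∀ v, (V.space v × U.space v) ≃ₗ[k] W.space v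
  comm : ∀ a x y, φ (Q.tgt a) (V.map a x + z a y, U.map a y) = W.map a (φ (Q.src a) (x, y))

theorem Fr.ext_app {U V W : QRep Q k} {e e' : Fr U V W}
    (h' : ∀ v x, e.φ v x = e'.φ v x) : e = e' := by
  obtain ⟨z, φ, c⟩ := e
  obtain ⟨z', φ', c'⟩ := e'
  have h : φ = φ' := funext fun v => LinearEquiv.ext (h' v)
  subst h
  have : z = z' := by
    funext a
    ext y
    have h1 := (c a 0 y).trans (c' a 0 y).symm
    have h2 := congrArg Prod.fst ((φ _).injective h1)
    simpa using h2
  subst this; rfl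

/-- The isomorphism from the middle term. -/
def Fr.iso {U V W : QRep Q k} (e : Fr U V W) : Iso (middle e.z) W :=
  ⟨e.φ, fun a x => e.comm a x.1 x.2⟩

/-- A frame from an isomorphism. -/
def Fr.ofIso {U V W : QRep Q k} (z : Cochain U V) (p : Iso (middle z) W) : Fr U V W :=
  ⟨z, p.app, fun a x y => p.comm a (x, y)⟩

theorem card_fr_iso (U V W : QRep Q k) :
    Nat.card (Fr U V W) =
      Nat.card {z : Cochain U V // IsIsomorphic (middle z) W} * autCard W := by
  unfold autCard
  refine card_torsor (fun e => ⟨e.z, ⟨e.iso⟩⟩) ?_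
    (fun e t => Fr.ofIso e.z (isoTrans e.iso t)) ?_ ?_
  · rintro ⟨z, ⟨p⟩⟩
    exact ⟨Fr.ofIso z p, rfl⟩
  · intro e t t' h
    refine Iso.ext_app fun v x => ?_
    have h1 := congrArg (fun s : Fr U V W => s.φ v ((e.φ v).symm x)) h
    have h2 : t.app v (e.φ v ((e.φ v).symm x)) = t'.app v (e.φ v ((e.φ v).symm x)) := h1
    simpa using h2
  · intro e e'
    constructor
    · intro h
      have hz : e'.z = e.z := congrArg Subtype.val h
      obtain ⟨z, φ, c⟩ := e
      obtain ⟨z', φ', c'⟩ := e'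
      dsimp only at hz
      subst hz
      refine ⟨isoTrans (isoSymm (Fr.iso ⟨z', φ, c⟩)) (Fr.iso ⟨z', φ', c'⟩), ?_⟩
      refine Fr.ext_app fun v x => ?_
      exact congrArg (φ' v) ((φ v).symm_apply_apply x)
    · rintro ⟨t, rfl⟩
      rfl

/-- The shear automorphism attached to a linear map. -/
def shear {A B : Type} [AddCommGroup A] [Module k A] [AddCommGroup B] [Module k B]
    (h : B →ₗ[k] A) : (A × B) ≃ₗ[k] (A × B) where
  toFun p := (p.1 + h p.2, p.2)
  map_add' p r := by
    ext
    · simp only [Prod.fst_add, Prod.snd_add, map_add]; abel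
    · rfl
  map_smul' c p := by
    ext
    · simp
    · rfl
  invFun p := (p.1 - h p.2, p.2)
  left_inv p := by simp
  right_inv p := by simp

/-- The short exact sequence of a frame. -/
def Fr.ses {U V W : QRep Q k} (e : Fr U V W) : SES U V W where
  f := ⟨fun v => (e.φ v).toLinearMap.comp (LinearMap.inl k _ _), fun a x => by
    have := e.comm a x 0
    simpa using this⟩
  g := ⟨fun v => (LinearMap.snd k _ _).comp (e.φ v).symm.toLinearMap, fun a w => by
    obtain ⟨⟨x, y⟩, rfl⟩ := (e.φ _).surjective w
    have := e.comm a x y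
    simp [← this]⟩
  inj := fun v => (e.φ v).injective.comp (fun _ _ h => congrArg Prod.fst h)
  surj := fun v => Prod.snd_surjective.comp (e.φ v).symm.surjective
  exact := fun v w => by
    obtain ⟨⟨x, y⟩, rfl⟩ := (e.φ _).surjective w
    simp [eq_comm]

/-- Shearing a frame. -/
def Fr.act {U V W : QRep Q k} (e : Fr U V W) (h : ∀ v, U.space v →ₗ[k] V.space v) :
    Fr U V W where
  z := e.z + coboundary h
  φ := fun v => (shear (h v)).trans (e.φ v)
  comm := fun a x y => by
    have := e.comm a (x + h _ y) y
    simp only [LinearEquiv.trans_apply]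
    refine Eq.trans ?_ this
    congr 1
    ext
    · simp [shear, coboundary]; abel
    · simp [shear]

theorem Fr.ses_surjective (U V W : QRep Q k) :
    Function.Surjective (Fr.ses : Fr U V W → SES U V W) := by
  intro e
  have hs : ∀ v, ∃ s : U.space v →ₗ[k] W.space v, (e.g.app v).comp s = LinearMap.id := fun v =>
    LinearMap.exists_rightInverse_of_surjective _ (LinearMap.range_eq_top.2 (e.surj v))
  choose s hs using hs
  have hs' : ∀ v x, e.g.app v (s v x) = x := fun v x => LinearMap.congr_fun (hs v) x
  have hgf : ∀ v x, e.g.app v (e.f.app v x) = 0 := fun v x => (e.exact v _).2 ⟨x, rfl⟩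
  have hbij : ∀ v, Function.Bijective ((e.f.app v).coprod (s v)) := by
    intro v
    constructor
    · rw [injective_iff_map_eq_zero]
      rintro ⟨x, y⟩ h
      simp only [LinearMap.coprod_apply] at h
      have h1 := congrArg (e.g.app v) h
      simp only [map_add, hgf, hs', zero_add, map_zero] at h1
      subst h1
      simp only [map_zero, add_zero] at h
      have := e.inj v (h.trans (map_zero _).symm)
      simp [this]
    · intro w
      obtain ⟨x, hx⟩ := (e.exact v (w - s v (e.g.app v w))).1 (by simp [hs'])
      exact ⟨(x, e.g.app v w), by simp [hx]⟩
  let φ : ∀ v, (V.space v × U.space v) ≃ₗ[k] W.space v := fun v =>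
    LinearEquiv.ofBijective _ (hbij v)
  have hφ : ∀ v x y, φ v (x, y) = e.f.app v x + s v y := fun v x y => rfl
  let z : Cochain U V := fun a => (LinearMap.fst k _ _).comp
    ((φ (Q.tgt a)).symm.toLinearMap.comp
      ((W.map a).comp (s (Q.src a)) - (s (Q.tgt a)).comp (U.map a)))
  have hz : ∀ a y, e.f.app _ (z a y) = W.map a (s _ y) - s _ (U.map a y) := by
    intro a y
    obtain ⟨x, hx⟩ := (e.exact _ (W.map a (s _ y) - s _ (U.map a y))).1 (by
      simp [hs', e.g.comm])
    have h1 : z a y = x := by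
      have : (φ (Q.tgt a)).symm (W.map a (s _ y) - s _ (U.map a y)) = (x, 0) := by
        rw [LinearEquiv.symm_apply_eq, hφ, hx]; simp
      exact congrArg Prod.fst this
    rw [h1, hx]
  refine ⟨⟨z, φ, ?_⟩, SES.ext_app ?_ ?_⟩
  · intro a x y
    rw [hφ, hφ, map_add, map_add, hz, e.f.comm]; abel
  · intro v x
    have : φ v (x, 0) = e.f.app v x := by simp [hφ]
    exact this
  · intro v w
    obtain ⟨⟨x, y⟩, rfl⟩ := (φ v).surjective w
    have : ((φ v).symm (φ v (x, y))).2 = e.g.app v (φ v (x, y)) := by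
      rw [LinearEquiv.symm_apply_apply]; simp [hφ, hgf, hs']
    exact this

theorem card_fr_ses (U V W : QRep Q k) :
    Nat.card (Fr U V W) =
      Nat.card (SES U V W) * Nat.card (∀ v, U.space v →ₗ[k] V.space v) := by
  refine card_torsor Fr.ses (Fr.ses_surjective U V W) Fr.act ?_ ?_
  · intro e h h' hh
    funext v
    ext y
    have h1 : e.φ v (0 + h v y, y) = e.φ v (0 + h' v y, y) :=
      congrArg (fun s : Fr U V W => s.φ v (0, y)) hh
    simpa using congrArg Prod.fst ((e.φ v).injective h1)
  · intro e e'
    constructor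
    · intro hh
      have hf : ∀ v x, e'.φ v (x, 0) = e.φ v (x, 0) := fun v x =>
        congrArg (fun s : SES U V W => s.f.app v x) hh
      have hg : ∀ v w, ((e'.φ v).symm w).2 = ((e.φ v).symm w).2 := fun v w =>
        congrArg (fun s : SES U V W => s.g.app v w) hh
      refine ⟨fun v => (LinearMap.fst k _ _).comp ((e.φ v).symm.toLinearMap.comp
        ((e'.φ v).toLinearMap.comp (LinearMap.inr k _ _))), Fr.ext_app ?_⟩
      rintro v ⟨x, y⟩
      have h2 : (e.φ v).symm (e'.φ v (0, y)) = (((e.φ v).symm (e'.φ v (0, y))).1, y) := by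
        ext
        · rfl
        · rw [← hg]; simp
      have h3 : e'.φ v (x, y) = e.φ v (x, 0) + e'.φ v (0, y) := by
        rw [← hf, ← map_add]; simp
      have h4 : e.φ v (x + ((e.φ v).symm (e'.φ v (0, y))).1, y) = e'.φ v (x, y) := by
        rw [h3, ← LinearEquiv.eq_symm_apply, map_add, LinearEquiv.symm_apply_apply]
        refine Eq.trans ?_ (congrArg (fun p => (x, (0 : U.space v)) + p) h2.symm)
        simp
      exact h4
    · rintro ⟨h, rfl⟩
      refine SES.ext_app ?_ ?_
      · intro v x
        have : e.φ v (x + h v 0, 0) = e.φ v (x, 0) := by simp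
        exact this
      · intro v w
        rfl

theorem coboundary_add {U V : QRep Q k} (f g : ∀ v, U.space v →ₗ[k] V.space v) :
    coboundary (f + g) = coboundary f + coboundary g := by
  funext a
  ext x
  simp [coboundary]; abel

theorem coboundary_neg {U V : QRep Q k} (f : ∀ v, U.space v →ₗ[k] V.space v) :
    coboundary (-f) = - coboundary f := by
  funext a
  ext x
  simp [coboundary]; abel

theorem coboundary_zero {U V : QRep Q k} :
    coboundary (0 : ∀ v, U.space v →ₗ[k] V.space v) = 0 := by
  funext a
  ext x
  simp [coboundary]

theorem card_c0 (U V : QRep Q k) :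
    Nat.card (∀ v, U.space v →ₗ[k] V.space v) =
      Nat.card (Set.range (coboundary : (∀ v, U.space v →ₗ[k] V.space v) → Cochain U V)) *
        homCard U V := by
  unfold homCard
  refine card_torsor (fun f => ⟨coboundary f, f, rfl⟩) ?_ (fun f t => f + t.app) ?_ ?_
  · rintro ⟨_, f, rfl⟩
    exact ⟨f, rfl⟩
  · intro f t t' h
    have h1 : t.app = t'.app := add_left_cancel h
    exact Hom.ext_app fun v x => by rw [h1]
  · intro f f'
    constructor
    · intro h
      have h1 : coboundary f' = coboundary f := congrArg Subtype.val h
      have h2 : coboundary (-f + f') = 0 := by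
        rw [coboundary_add, coboundary_neg, h1, neg_add_cancel]
      refine ⟨⟨-f + f', fun a x => ?_⟩, by simp⟩
      have h3 := LinearMap.congr_fun (congrFun h2 a) x
      exact (sub_eq_zero.1 h3).symm
    · rintro ⟨t, rfl⟩
      refine Subtype.ext ?_
      change coboundary (f + t.app) = coboundary f
      have : coboundary t.app = 0 := by
        funext a
        ext x
        exact sub_eq_zero.2 (t.comm a x).symm
      rw [coboundary_add, this, add_zero]

theorem extRel_equiv (U V : QRep Q k) : Equivalence (extRel U V) where
  refl z := ⟨0, by rw [coboundary_zero, add_zero]⟩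
  symm := by
    rintro z _ ⟨f, rfl⟩
    exact ⟨-f, by rw [coboundary_neg]; simp⟩
  trans := by
    rintro z _ _ ⟨f, rfl⟩ ⟨g, rfl⟩
    exact ⟨f + g, by rw [coboundary_add, add_assoc]⟩

theorem middle_add {U V W : QRep Q k} (z : Cochain U V)
    (f : ∀ v, U.space v →ₗ[k] V.space v) (h : IsIsomorphic (middle z) W) :
    IsIsomorphic (middle (z + coboundary f)) W := by
  obtain ⟨p⟩ := h
  exact ⟨((Fr.ofIso z p).act f).iso⟩

theorem card_z (U V W : QRep Q k) :
    Nat.card {z : Cochain U V // IsIsomorphic (middle z) W} =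
      extWCard U V W *
      Nat.card (Set.range
        (coboundary : (∀ v, U.space v →ₗ[k] V.space v) → Cochain U V)) := by
  unfold extWCard
  refine card_torsor (fun z => ⟨Quot.mk _ z.1, z.1, rfl, z.2⟩) ?_
    (fun z b => ⟨z.1 + b.1, ?_⟩) ?_ ?_
  · rintro ⟨_, z, rfl, hz⟩
    exact ⟨⟨z, hz⟩, rfl⟩
  · obtain ⟨_, f, rfl⟩ := b
    exact middle_add z.1 f z.2
  · intro z b b' h
    exact Subtype.ext (add_left_cancel (congrArg Subtype.val h))
  · intro z z'
    constructor
    · intro h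
      have h1 : Quot.mk (extRel U V) z.1 = Quot.mk _ z'.1 := (congrArg Subtype.val h).symm
      obtain ⟨f, hf⟩ := ((extRel_equiv U V).quot_mk_eq_iff _ _).1 h1
      exact ⟨⟨_, f, rfl⟩, Subtype.ext hf.symm⟩
    · rintro ⟨⟨_, f, rfl⟩, rfl⟩
      exact Subtype.ext (Quot.sound ⟨f, rfl⟩).symm

theorem finite_c0 [Fintype k] (U V : QRep Q k) :
    Finite (∀ v, U.space v →ₗ[k] V.space v) := by
  have h : ∀ (M : QRep Q k) v, Finite (M.space v) := fun M v => Module.finite_of_finite k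
  have := h U
  have := h V
  have : ∀ v, Finite (U.space v →ₗ[k] V.space v) := fun v =>
    Finite.of_injective _ DFunLike.coe_injective
  infer_instance

theorem homCard_ne_zero [Fintype k] (U V : QRep Q k) : homCard U V ≠ 0 := by
  have := finite_c0 U V
  have : Finite (Hom U V) := Finite.of_injective (fun t => t.app) (fun t t' h =>
    Hom.ext_app fun v x => by
      have h' : t.app = t'.app := h
      rw [h'])
  have : Nonempty (Hom U V) := ⟨⟨0, fun a x => by simp⟩⟩
  exact Nat.card_pos.ne'

theorem autCard_ne_zero [Fintype k] (U : QRep Q k) : autCard U ≠ 0 := by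
  have := finite_c0 U U
  have : Finite (Iso U U) := Finite.of_injective (fun t v => (t.app v).toLinearMap)
    (fun t t' h => Iso.ext_app fun v x => LinearMap.congr_fun (congrFun h v) x)
  have : Nonempty (Iso U U) := ⟨⟨fun v => LinearEquiv.refl _ _, fun a x => rfl⟩⟩
  exact Nat.card_pos.ne'

end Riedtmann

/-- Riedtmann's formula:
`F_{UV}^W = (|Ext_Q(U,V)_W| / |Hom_Q(U,V)|) * (a_W / (a_U * a_V))`. -/
theorem statement0 (Q : FinQuiver) (k : Type) [Field k] [Fintype k]
    (U V W : QRep Q k) :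
    (hallNum U V W : ℚ) =
      ((extWCard U V W : ℚ) / (homCard U V : ℚ)) *
        ((autCard W : ℚ) / ((autCard U : ℚ) * (autCard V : ℚ))) := by
  have hB : Nat.card (Set.range
      (coboundary : (∀ v, U.space v →ₗ[k] V.space v) → Cochain U V)) ≠ 0 := by
    have := finite_c0 U V
    exact Nat.card_pos.ne'
  have key := (card_fr_iso U V W).symm.trans (card_fr_ses U V W)
  rw [card_z, card_ses, card_c0] at key
  have hH := homCard_ne_zero U V
  have hU := autCard_ne_zero U
  have hV := autCard_ne_zero V
  have key2 : extWCard U V W * autCard W =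
      hallNum U V W * (autCard V * autCard U) * homCard U V := by
    apply Nat.eq_of_mul_eq_mul_right (Nat.pos_of_ne_zero hB)
    linarith [key]
  have key3 : (extWCard U V W : ℚ) * autCard W =
      hallNum U V W * (autCard V * autCard U) * homCard U V := by exact_mod_cast key2
  have hH' : (homCard U V : ℚ) ≠ 0 := by exact_mod_cast hH
  have hU' : (autCard U : ℚ) ≠ 0 := by exact_mod_cast hU
  have hV' : (autCard V : ℚ) ≠ 0 := by exact_mod_cast hV
  rw [div_mul_div_comm, key3]
  field_simp

end HallPaper
end

section
/- Let U, V be representations of a finite quiver Q over F_q with dimension vectors alpha_1, alpha_2. Then for every dimension vector gamma: Sum over pairs (gamma_1, gamma_2) with gamma_1 + gamma_2 = gamma of q^{<gamma_1, alpha_2 - gamma_2>_a} * |Gr_{gamma_1}(U)| * |Gr_{gamma_2}(V)| = Sum over isomorphism classes [W] of representations with dim W = alpha_1 + alpha_2 of (|Ext_Q(U,V)_W| / |Ext^1_Q(U,V)|) * |Gr_gamma(W)|. Equivalently, the map [W] -> a_W^{-1} Sum_gamma |Gr_gamma(W)| x^{dim W - gamma} y^{gamma} is an algebra homomorphism from the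 completed Hall algebra H(Q) to the double quantum polynomial algebra with multiplication (x^{beta_1} y^{gamma_1})(x^{beta_2} y^{gamma_2}) = q^{<gamma_1,beta_2>_a - <beta_1+beta_2, gamma_1+gamma_2>_a} x^{beta_1+beta_2} y^{gamma_1+gamma_2}. -/
/- Common setup: finite quivers, finite-dimensional representations over a
finite field, subrepresentations, quotients, Hall numbers, quiver
Grassmannians and flags, extensions, and the (completed) Hall algebra,
following J. Fei, "Counting using Hall algebras I. Quivers". -/

open scoped BigOperators

attribute [local instance] Classical.propDecidable

namespace HallPaper

open QRep

section Helpers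

variable {Q : FinQuiver} {k : Type} [Field k]

namespace QRep

/-- Inverse of an isomorphism. -/
def Iso.symm' {M N : QRep Q k} (f : Iso M N) : Iso N M :=
  ⟨fun v => (f.app v).symm, fun a x => by
    rw [LinearEquiv.symm_apply_eq, f.comm, LinearEquiv.apply_symm_apply]⟩

/-- Composite of isomorphisms. -/
def Iso.trans' {M N P : QRep Q k} (f : Iso M N) (g : Iso N P) : Iso M P :=
  ⟨fun v => (f.app v).trans (g.app v), fun a x => by
    simp only [LinearEquiv.trans_apply, f.comm, g.comm]⟩

theorem IsIsomorphic.symm' {M N : QRep Q k} (h : IsIsomorphic M N) : IsIsomorphic N M :=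
  h.map Iso.symm'

theorem IsIsomorphic.trans' {M N P : QRep Q k} (h : IsIsomorphic M N)
    (h' : IsIsomorphic N P) : IsIsomorphic M P :=
  ⟨h.some.trans' h'.some⟩

theorem IsIsomorphic.refl' (M : QRep Q k) : IsIsomorphic M M :=
  ⟨⟨fun _ => LinearEquiv.refl _ _, fun _ _ => rfl⟩⟩

theorem SubRep.ext' {M : QRep Q k} {L L' : SubRep M} (h : ∀ v, L.sub v = L'.sub v) :
    L = L' := by
  cases L; cases L'
  congr
  funext v
  exact h v

/-- Push a subrepresentation along an isomorphism. -/
def SubRep.push {M N : QRep Q k} (f : Iso M N) (L : SubRep M) : SubRep N where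
  sub := fun v => (L.sub v).map (f.app v).toLinearMap
  stable := by
    rintro a _ ⟨x, hx, rfl⟩
    exact ⟨M.map a x, L.stable a x hx, f.comm a x⟩

theorem SubRep.push_dim {M N : QRep Q k} (f : Iso M N) (L : SubRep M) :
    (L.push f).dim = L.dim := by
  funext v
  exact LinearEquiv.finrank_map_eq (f.app v) (L.sub v)

theorem SubRep.push_push {M N : QRep Q k} (f : Iso M N) (L : SubRep M) :
    (L.push f).push f.symm' = L := by
  apply SubRep.ext'
  intro v
  ext x
  simp [SubRep.push, Iso.symm']

theorem SubRep.push_push' {M N : QRep Q k} (f : Iso M N) (L : SubRep N) :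
    (L.push f.symm').push f = L := by
  apply SubRep.ext'
  intro v
  ext x
  simp [SubRep.push, Iso.symm']

theorem grCard_iso {M N : QRep Q k} (h : IsIsomorphic M N) (γ : Q.V → ℕ) :
    grCard γ M = grCard γ N := by
  obtain ⟨f⟩ := h
  refine Nat.card_congr
    { toFun := fun L => ⟨L.1.push f, by rw [SubRep.push_dim, L.2]⟩
      invFun := fun L => ⟨L.1.push f.symm', by rw [SubRep.push_dim, L.2]⟩
      left_inv := fun L => Subtype.ext (SubRep.push_push f L.1)
      right_inv := fun L => Subtype.ext (SubRep.push_push' f L.1) }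

theorem exists_std (M : QRep Q k) (α : Q.V → ℕ) (h : M.dimVec = α) :
    ∃ W : StdRep Q k α, IsIsomorphic M W.toQRep := by
  have hb : ∀ v, Nonempty (M.space v ≃ₗ[k] (Fin (α v) → k)) := fun v => by
    apply FiniteDimensional.nonempty_linearEquiv_of_finrank_eq
    rw [Module.finrank_fin_fun, ← h]; rfl
  let e := fun v => (hb v).some
  refine ⟨fun a => LinearMap.toMatrix'
    (((e (Q.tgt a)).toLinearMap.comp (M.map a)).comp (e (Q.src a)).symm.toLinearMap), ⟨⟨e, ?_⟩⟩⟩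
  intro a x
  simp only [StdRep.toQRep]
  change _ = Matrix.toLin' _ _
  rw [Matrix.toLin'_toMatrix']
  change _ = e (Q.tgt a) (M.map a ((e (Q.src a)).symm (e (Q.src a) x)))
  rw [LinearEquiv.symm_apply_apply]
  rfl

theorem isoRel_equiv (α : Q.V → ℕ) : Equivalence (isoRel Q k α) :=
  ⟨fun _ => IsIsomorphic.refl' _, fun h => h.symm', fun h h' => h.trans' h'⟩

theorem exists_class (M : QRep Q k) (α : Q.V → ℕ) (h : M.dimVec = α) :
    ∃ c : IsoClass Q k α, ∀ c', IsIsomorphic M (IsoClass.rep c') ↔ c' = c := by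
  obtain ⟨W, hW⟩ := exists_std M α h
  refine ⟨Quot.mk _ W, fun c' => ?_⟩
  have key : isoRel Q k α W (Quot.out c') ↔ Quot.mk (isoRel Q k α) W = c' := by
    conv_rhs => rw [← Quot.out_eq c']
    rw [Quot.eq, (isoRel_equiv α).eqvGen_iff]
  constructor
  · intro h'
    exact (key.1 (hW.symm'.trans' h')).symm
  · intro h'
    exact hW.trans' (key.2 h'.symm)

theorem coboundary_add {U V : QRep Q k} (f g : ∀ v, U.space v →ₗ[k] V.space v) :
    coboundary (fun v => f v + g v) = coboundary f + coboundary g := by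
  funext a
  ext x
  simp [coboundary]
  abel

theorem coboundary_neg {U V : QRep Q k} (f : ∀ v, U.space v →ₗ[k] V.space v) :
    coboundary (fun v => - f v) = - coboundary f := by
  funext a
  ext x
  simp [coboundary]
  abel

theorem coboundary_zero {U V : QRep Q k} :
    coboundary (fun v => (0 : U.space v →ₗ[k] V.space v)) = 0 := by
  funext a
  ext x
  simp [coboundary]

theorem extRel_equiv (U V : QRep Q k) : Equivalence (extRel U V) where
  refl := fun z => ⟨fun _ => 0, by rw [coboundary_zero, add_zero]⟩
  symm := by
    rintro z z' ⟨f, rfl⟩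
    exact ⟨fun v => - f v, by rw [coboundary_neg]; abel⟩
  trans := by
    rintro z z' z'' ⟨f, rfl⟩ ⟨g, rfl⟩
    exact ⟨fun v => f v + g v, by rw [coboundary_add]; abel⟩

theorem quot_eq_iff {U V : QRep Q k} (z z' : Cochain U V) :
    Quot.mk (extRel U V) z = Quot.mk (extRel U V) z' ↔ extRel U V z z' := by
  rw [Quot.eq, (extRel_equiv U V).eqvGen_iff]

theorem middle_iso {U V : QRep Q k} {z z' : Cochain U V} (h : extRel U V z z') :
    IsIsomorphic (middle z) (middle z') := by
  obtain ⟨f, rfl⟩ := h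
  refine ⟨⟨fun v =>
    { toFun := fun x => (x.1 - f v x.2, x.2)
      invFun := fun x => (x.1 + f v x.2, x.2)
      map_add' := fun x y => ?_
      map_smul' := fun c x => ?_
      left_inv := fun x => ?_
      right_inv := fun x => ?_ }, ?_⟩⟩
  · apply Prod.ext
    · change (x.1 + y.1) - f v (x.2 + y.2) = (x.1 - f v x.2) + (y.1 - f v y.2)
      rw [map_add]; abel
    · rfl
  · apply Prod.ext
    · change (c • x.1) - f v (c • x.2) = c • (x.1 - f v x.2)
      rw [map_smul, smul_sub]
    · rfl
  · exact Prod.ext (sub_add_cancel _ _) rfl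
  · exact Prod.ext (add_sub_cancel_right _ _) rfl
  · rintro a ⟨x, y⟩
    apply Prod.ext
    · change (V.map a x + z a y) - f _ (U.map a y) =
        V.map a (x - f _ y) + (z a y + (V.map a (f _ y) - f _ (U.map a y)))
      rw [map_sub]; abel
    · rfl

theorem fiber_card {U V : QRep Q k} (e : Quot (extRel U V)) :
    Nat.card {z : Cochain U V // Quot.mk _ z = e} =
      Nat.card {z : Cochain U V // ∃ f, z = coboundary f} := by
  induction e using Quot.ind with
  | mk z0 =>
  refine Nat.card_congr
    { toFun := fun z => ⟨z.1 - z0, ?_⟩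
      invFun := fun z => ⟨z.1 + z0, ?_⟩
      left_inv := fun z => Subtype.ext (sub_add_cancel _ _)
      right_inv := fun z => Subtype.ext (add_sub_cancel_right _ _) }
  · obtain ⟨f, hf⟩ := (quot_eq_iff _ _).1 z.2.symm
    exact ⟨f, by rw [hf]; abel⟩
  · obtain ⟨f, hf⟩ := z.2
    exact ((quot_eq_iff _ _).2 ⟨f, by rw [hf]; abel⟩).symm

section Fin
variable [Fintype k]

theorem finite_space (M : QRep Q k) (v : Q.V) : Finite (M.space v) :=
  Module.finite_of_finite k

theorem finite_hom (M N : Type) [AddCommGroup M] [AddCommGroup N] [Module k M] [Module k N]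
    [FiniteDimensional k M] [FiniteDimensional k N] : Finite (M →ₗ[k] N) :=
  Module.finite_of_finite k

instance finite_cochain (U V : QRep Q k) : Finite (Cochain U V) := by
  have : ∀ a, Finite (U.space (Q.src a) →ₗ[k] V.space (Q.tgt a)) := fun a => finite_hom _ _
  infer_instance

instance finite_fam (U V : QRep Q k) : Finite (∀ v, U.space v →ₗ[k] V.space v) := by
  have : ∀ a, Finite (U.space a →ₗ[k] V.space a) := fun a => finite_hom _ _
  infer_instance

instance finite_subRep (M : QRep Q k) : Finite (SubRep M) := by
  have : ∀ v, Finite (M.space v) := finite_space M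
  have : ∀ v, Finite (Submodule k (M.space v)) := fun v =>
    Finite.of_injective (fun L => (L : Set (M.space v))) SetLike.coe_injective
  exact Finite.of_injective (fun L : SubRep M => L.sub)
    (fun L L' h => SubRep.ext' (fun v => congrFun h v))

theorem natCard_sub {α : Type} [Fintype α] (p : α → Prop) :
    ((Nat.card {x // p x} : ℕ) : ℚ) = ∑ x, if p x then (1 : ℚ) else 0 := by
  rw [Nat.card_eq_fintype_card, Fintype.card_subtype, Finset.sum_boole]

theorem sum_quot {U V : QRep Q k} [Fintype (Cochain U V)] [Fintype (Quot (extRel U V))]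
    (h : Quot (extRel U V) → ℚ) :
    ∑ z : Cochain U V, h (Quot.mk _ z) =
      (Nat.card {z : Cochain U V // ∃ f, z = coboundary f} : ℚ) * ∑ e, h e := by
  rw [← Finset.sum_fiberwise Finset.univ (fun z : Cochain U V => Quot.mk (extRel U V) z),
    Finset.mul_sum]
  refine Finset.sum_congr rfl fun e _ => ?_
  rw [← fiber_card e, natCard_sub, Finset.sum_mul, Finset.sum_filter]
  refine Finset.sum_congr rfl fun z _ => ?_
  split_ifs with hz
  · rw [hz, one_mul]
  · rw [zero_mul]

theorem rhs_eq (U V : QRep Q k) [Fintype (Cochain U V)] (γ : Q.V → ℕ) :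
    (∑ᶠ c : IsoClass Q k (U.dimVec + V.dimVec),
      ((extWCard U V c.rep : ℚ) / (ext1Card U V : ℚ)) * (grCard γ c.rep : ℚ)) =
    (∑ z : Cochain U V, (grCard γ (middle z) : ℚ)) / (Fintype.card (Cochain U V) : ℚ) := by
  have : Finite (IsoClass Q k (U.dimVec + V.dimVec)) :=
    Finite.of_surjective (Quot.mk _) Quot.mk_surjective
  have := Fintype.ofFinite (IsoClass Q k (U.dimVec + V.dimVec))
  have : Finite (Quot (extRel U V)) :=
    Finite.of_surjective (Quot.mk _) Quot.mk_surjective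
  have := Fintype.ofFinite (Quot (extRel U V))
  rw [finsum_eq_sum_of_fintype]
  let P : Quot (extRel U V) → IsoClass Q k (U.dimVec + V.dimVec) → Prop := fun e c =>
    ∃ z : Cochain U V, Quot.mk _ z = e ∧ IsIsomorphic (middle z) c.rep
  let h : Quot (extRel U V) → ℚ := fun e => ∑ c, if P e c then (grCard γ c.rep : ℚ) else 0
  have hh : ∀ z : Cochain U V, h (Quot.mk _ z) = grCard γ (middle z) := by
    intro z
    have hd : (middle z).dimVec = U.dimVec + V.dimVec := by
      funext v
      change Module.finrank k (V.space v × U.space v) = _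
      rw [Module.finrank_prod, add_comm]; rfl
    obtain ⟨c, hc⟩ := exists_class (middle z) _ hd
    have hP : ∀ c', P (Quot.mk _ z) c' ↔ c' = c := by
      intro c'
      rw [← hc]
      constructor
      · rintro ⟨z', hz', hi⟩
        exact (middle_iso ((quot_eq_iff _ _).1 hz'.symm)).trans' hi
      · intro hi
        exact ⟨z, rfl, hi⟩
    simp only [h, hP, Finset.sum_ite_eq', Finset.mem_univ, if_true]
    rw [grCard_iso ((hc c).2 rfl)]
  have h1 := sum_quot h
  simp only [hh] at h1
  have h2 := sum_quot (fun _ : Quot (extRel U V) => (1 : ℚ))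
  simp only [Finset.sum_const, Finset.card_univ, nsmul_eq_mul, mul_one] at h2
  have h3 : (∑ c : IsoClass Q k (U.dimVec + V.dimVec),
      ((extWCard U V c.rep : ℚ) / (ext1Card U V : ℚ)) * (grCard γ c.rep : ℚ)) =
      (∑ e, h e) / (ext1Card U V : ℚ) := by
    simp only [h]
    rw [Finset.sum_comm, Finset.sum_div]
    refine Finset.sum_congr rfl fun c _ => ?_
    rw [extWCard, natCard_sub, div_mul_eq_mul_div, Finset.sum_mul]
    congr 1
    refine Finset.sum_congr rfl fun e _ => ?_
    by_cases hp : P e c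
    · rw [if_pos hp, if_pos hp, one_mul]
    · rw [if_neg hp, if_neg hp, zero_mul]
  rw [h3, h1, h2, ext1Card, Nat.card_eq_fintype_card (α := Quot (extRel U V))]
  have hB : (Nat.card {z : Cochain U V // ∃ f, z = coboundary f} : ℚ) ≠ 0 := by
    intro h0
    rw [h0, zero_mul] at h2
    have : (Fintype.card (Cochain U V)) ≠ 0 := Fintype.card_ne_zero
    exact this (by exact_mod_cast h2)
  rw [mul_div_mul_left _ _ hB]

end Fin

section LinAlg

variable {A B : Type} [AddCommGroup A] [AddCommGroup B] [Module k A] [Module k B]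

/-- The subspace of `A × B` given by a linear map from a subspace of `B` to a quotient of `A`. -/
def gsub (A1 : Submodule k A) (B1 : Submodule k B) (φ : B1 →ₗ[k] A ⧸ A1) :
    Submodule k (A × B) where
  carrier := {x | ∃ h : x.2 ∈ B1, φ ⟨x.2, h⟩ = A1.mkQ x.1}
  add_mem' := by
    rintro x y ⟨hx, ex⟩ ⟨hy, ey⟩
    refine ⟨B1.add_mem hx hy, ?_⟩
    change φ (⟨x.2, hx⟩ + ⟨y.2, hy⟩) = A1.mkQ (x.1 + y.1)
    rw [map_add, map_add, ex, ey]
  zero_mem' := ⟨B1.zero_mem, by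
    change φ 0 = A1.mkQ 0
    rw [map_zero, map_zero]⟩
  smul_mem' := by
    rintro c x ⟨hx, ex⟩
    refine ⟨B1.smul_mem c hx, ?_⟩
    change φ (c • ⟨x.2, hx⟩) = A1.mkQ (c • x.1)
    rw [map_smul, map_smul, ex]

theorem mem_gsub {A1 : Submodule k A} {B1 : Submodule k B} {φ : B1 →ₗ[k] A ⧸ A1} {x : A × B} :
    x ∈ gsub A1 B1 φ ↔ ∃ h : x.2 ∈ B1, φ ⟨x.2, h⟩ = A1.mkQ x.1 := Iff.rfl

theorem gsub_comap (A1 : Submodule k A) (B1 : Submodule k B) (φ : B1 →ₗ[k] A ⧸ A1) :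
    (gsub A1 B1 φ).comap (LinearMap.inl k A B) = A1 := by
  ext x
  rw [Submodule.mem_comap, mem_gsub]
  constructor
  · rintro ⟨h, e⟩
    have : φ 0 = A1.mkQ x := e
    rw [map_zero] at this
    exact (Submodule.Quotient.mk_eq_zero A1).1 this.symm
  · intro hx
    refine ⟨B1.zero_mem, ?_⟩
    change φ 0 = A1.mkQ x
    rw [map_zero]
    exact ((Submodule.Quotient.mk_eq_zero A1).2 hx).symm

theorem gsub_map (A1 : Submodule k A) (B1 : Submodule k B) (φ : B1 →ₗ[k] A ⧸ A1) :
    (gsub A1 B1 φ).map (LinearMap.snd k A B) = B1 := by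
  ext y
  rw [Submodule.mem_map]
  constructor
  · rintro ⟨x, ⟨h, e⟩, rfl⟩
    exact h
  · intro hy
    obtain ⟨x, hx⟩ := A1.mkQ_surjective (φ ⟨y, hy⟩)
    exact ⟨(x, y), ⟨hy, hx.symm⟩, rfl⟩

theorem gsub_inj {A1 : Submodule k A} {B1 : Submodule k B} {φ ψ : B1 →ₗ[k] A ⧸ A1}
    (h : gsub A1 B1 φ = gsub A1 B1 ψ) : φ = ψ := by
  ext y
  obtain ⟨x, hx⟩ := A1.mkQ_surjective (φ y)
  have : (x, (y : B)) ∈ gsub A1 B1 φ := ⟨y.2, hx.symm⟩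
  rw [h] at this
  obtain ⟨_, e⟩ := this
  rw [← hx]
  exact e.symm

theorem gsub_surj (L : Submodule k (A × B)) :
    ∃ φ : (L.map (LinearMap.snd k A B)) →ₗ[k] A ⧸ (L.comap (LinearMap.inl k A B)),
      gsub _ _ φ = L := by
  let p : L →ₗ[k] (L.map (LinearMap.snd k A B)) :=
    ((LinearMap.snd k A B).domRestrict L).codRestrict _
      (fun x => ⟨x.1, x.2, rfl⟩)
  have hp : Function.Surjective p := by
    rintro ⟨_, x, hx, rfl⟩
    exact ⟨⟨x, hx⟩, rfl⟩
  obtain ⟨s, hs⟩ := p.exists_rightInverse_of_surjective (LinearMap.range_eq_top.2 hp)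
  refine ⟨(Submodule.mkQ _).comp ((LinearMap.fst k A B).comp (L.subtype.comp s)), ?_⟩
  have h2 : ∀ y, (s y).1.2 = y.1 := fun y => congrArg Subtype.val (LinearMap.congr_fun hs y)
  ext x
  rw [mem_gsub]
  constructor
  · rintro ⟨h, e⟩
    have e' := (Submodule.Quotient.eq _).1 e
    have h3 : ((s ⟨x.2, h⟩).1.1 - x.1, (0 : B)) ∈ L := e'
    have h4 := L.sub_mem (s ⟨x.2, h⟩).2 h3
    convert h4 using 1
    apply Prod.ext
    · simp
    · simp [h2]
  · intro hx
    refine ⟨⟨x, hx, rfl⟩, ?_⟩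
    refine (Submodule.Quotient.eq _).2 ?_
    change ((s ⟨x.2, _⟩).1.1 - x.1, (0 : B)) ∈ L
    have h4 := L.sub_mem (s ⟨x.2, ⟨x, hx, rfl⟩⟩).2 hx
    convert h4 using 1
    apply Prod.ext
    · simp
    · simp [h2]

theorem gsub_finrank [FiniteDimensional k A] [FiniteDimensional k B]
    (A1 : Submodule k A) (B1 : Submodule k B) (φ : B1 →ₗ[k] A ⧸ A1) :
    Module.finrank k (gsub A1 B1 φ) = Module.finrank k B1 + Module.finrank k A1 := by
  obtain ⟨s, hs⟩ := A1.mkQ.exists_rightInverse_of_surjective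
    (LinearMap.range_eq_top.2 A1.mkQ_surjective)
  have hs' : ∀ y, A1.mkQ (s y) = y := fun y => LinearMap.congr_fun hs y
  let j : (B1 × A1) →ₗ[k] A × B :=
    ((A1.subtype.comp (LinearMap.snd k B1 A1)) +
      ((s.comp φ).comp (LinearMap.fst k B1 A1))).prod (B1.subtype.comp (LinearMap.fst k B1 A1))
  have hj : ∀ y x, j (y, x) = (x.1 + s (φ y), y.1) := fun _ _ => rfl
  have hinj : Function.Injective j := by
    rintro ⟨y, x⟩ ⟨y', x'⟩ h
    rw [hj, hj, Prod.mk.injEq] at h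
    obtain rfl : y = y' := Subtype.ext h.2
    obtain rfl : x = x' := Subtype.ext (add_right_cancel h.1)
    rfl
  have hr : LinearMap.range j = gsub A1 B1 φ := by
    ext x
    rw [mem_gsub]
    constructor
    · rintro ⟨⟨y, x⟩, rfl⟩
      rw [hj]
      refine ⟨y.2, ?_⟩
      change φ y = A1.mkQ (x.1 + s (φ y))
      have h0 : A1.mkQ x.1 = 0 := (Submodule.Quotient.mk_eq_zero A1).2 x.2
      rw [map_add, hs', h0, zero_add]
    · rintro ⟨h, e⟩
      have : x.1 - s (φ ⟨x.2, h⟩) ∈ A1 := by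
        rw [← Submodule.Quotient.mk_eq_zero A1]
        change A1.mkQ _ = 0
        rw [map_sub, hs', e, sub_self]
      exact ⟨(⟨x.2, h⟩, ⟨_, this⟩), by rw [hj]; exact Prod.ext (sub_add_cancel _ _) rfl⟩
  rw [← hr, LinearMap.finrank_range_of_inj hinj, Module.finrank_prod]

end LinAlg

/-- Restriction of a cochain to a subrepresentation of the source and a quotient of the target. -/
def res {U V : QRep Q k} (U1 : SubRep U) (V1 : SubRep V) :
    Cochain U V →+ Cochain U1.toRep V1.quotRep where
  toFun := fun z a => (V1.sub (Q.tgt a)).mkQ.comp ((z a).comp (U1.sub (Q.src a)).subtype)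
  map_zero' := by
    funext a
    apply LinearMap.ext
    intro x
    exact map_zero (V1.sub (Q.tgt a)).mkQ
  map_add' := by
    intro z z'
    funext a
    apply LinearMap.ext
    intro x
    exact map_add (V1.sub (Q.tgt a)).mkQ _ _

theorem res_surj {U V : QRep Q k} (U1 : SubRep U) (V1 : SubRep V) :
    Function.Surjective (res U1 V1) := by
  intro w
  have : ∀ a, ∃ g : U.space (Q.src a) →ₗ[k] V.space (Q.tgt a),
      (V1.sub (Q.tgt a)).mkQ.comp (g.comp (U1.sub (Q.src a)).subtype) = w a := by
    intro a
    obtain ⟨s, hs⟩ := (V1.sub (Q.tgt a)).mkQ.exists_rightInverse_of_surjective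
      (LinearMap.range_eq_top.2 (V1.sub (Q.tgt a)).mkQ_surjective)
    obtain ⟨g, hg⟩ := LinearMap.exists_extend (p := U1.sub (Q.src a)) (s.comp (w a))
    refine ⟨g, ?_⟩
    rw [hg]
    apply LinearMap.ext
    intro x
    exact LinearMap.congr_fun hs (w a x)
  choose g hg using this
  exact ⟨g, funext hg⟩

theorem res_fiber {U V : QRep Q k} [Fintype k] (U1 : SubRep U) (V1 : SubRep V)
    (w : Cochain U1.toRep V1.quotRep) :
    Nat.card {z // res U1 V1 z = w} * Nat.card (Cochain U1.toRep V1.quotRep) =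
      Nat.card (Cochain U V) := by
  have h : ∀ w, Nat.card {z // res U1 V1 z = w} = Nat.card {z // res U1 V1 z = 0} := by
    intro w
    obtain ⟨z0, rfl⟩ := res_surj U1 V1 w
    exact Nat.card_congr
      { toFun := fun z => ⟨z.1 - z0, by rw [map_sub, z.2, sub_self]⟩
        invFun := fun z => ⟨z.1 + z0, by rw [map_add, z.2, zero_add]⟩
        left_inv := fun z => Subtype.ext (sub_add_cancel _ _)
        right_inv := fun z => Subtype.ext (add_sub_cancel_right _ _) }
  have := Fintype.ofFinite (Cochain U1.toRep V1.quotRep)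
  rw [← Nat.card_congr (Equiv.sigmaFiberEquiv (res U1 V1)), Nat.card_sigma]
  simp only [h, Finset.sum_const, Finset.card_univ, Nat.card_eq_fintype_card
    (α := Cochain U1.toRep V1.quotRep), smul_eq_mul, mul_comm]

theorem res_eq_iff {U V : QRep Q k} (U1 : SubRep U) (V1 : SubRep V) (z : Cochain U V)
    (φ : ∀ v, U1.sub v →ₗ[k] V.space v ⧸ V1.sub v) :
    res U1 V1 z = - coboundary (U := U1.toRep) (V := V1.quotRep) φ ↔
    ∀ a (x : (middle z).space (Q.src a)), x ∈ gsub (V1.sub (Q.src a)) (U1.sub (Q.src a)) (φ _) →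
      (middle z).map a x ∈ gsub (V1.sub (Q.tgt a)) (U1.sub (Q.tgt a)) (φ _) := by
  have key : ∀ a (x : V.space (Q.src a)) (y : U1.sub (Q.src a)),
      φ _ y = (V1.sub (Q.src a)).mkQ x →
      ((res U1 V1 z a y = (- coboundary (U := U1.toRep) (V := V1.quotRep) φ) a y) ↔
      φ _ ⟨U.map a y, U1.stable a _ y.2⟩ =
        (V1.sub (Q.tgt a)).mkQ (V.map a x + z a y)) := by
    intro a x y hxy
    change (V1.sub (Q.tgt a)).mkQ (z a y) =
      - ((V1.sub (Q.src a)).mapQ (V1.sub (Q.tgt a)) (V.map a) (fun x hx => V1.stable a x hx)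
          (φ _ y) - φ _ ⟨U.map a y, U1.stable a _ y.2⟩) ↔ _
    rw [hxy, map_add]
    change (V1.sub (Q.tgt a)).mkQ (z a y) =
      - ((V1.sub (Q.tgt a)).mkQ (V.map a x) - φ _ ⟨U.map a y, U1.stable a _ y.2⟩) ↔ _
    rw [neg_sub, eq_sub_iff_add_eq, eq_comm, add_comm]
  constructor
  · rintro h a ⟨x, y⟩ ⟨hy, e⟩
    exact ⟨U1.stable a _ hy, (key a x ⟨y, hy⟩ e).1 (by rw [h])⟩
  · intro h
    funext a
    apply LinearMap.ext
    intro y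
    obtain ⟨x, hx⟩ := (V1.sub (Q.src a)).mkQ_surjective (φ _ y)
    obtain ⟨h1, e⟩ := h a (x, y.1) ⟨y.2, hx.symm⟩
    exact (key a x y hx.symm).2 e

/-- The type parametrizing subrepresentations of the middle term. -/
abbrev Param (U V : QRep Q k) (γ : Q.V → ℕ) (z : Cochain U V) :=
  Σ p : {p : SubRep U × SubRep V // p.1.dim + p.2.dim = γ},
    {φ : ∀ v, p.1.1.toRep.space v →ₗ[k] p.1.2.quotRep.space v //
      res p.1.1 p.1.2 z = - coboundary φ}

/-- The subrepresentation of the middle term attached to a parameter. -/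
def paramSub {U V : QRep Q k} {γ : Q.V → ℕ} {z : Cochain U V} (t : Param U V γ z) :
    {L : SubRep (middle z) // L.dim = γ} :=
  ⟨⟨fun v => gsub (t.1.1.2.sub v) (t.1.1.1.sub v) (t.2.1 v),
    (res_eq_iff t.1.1.1 t.1.1.2 z t.2.1).1 t.2.2⟩, by
    funext v
    refine (gsub_finrank (t.1.1.2.sub v) (t.1.1.1.sub v) (t.2.1 v)).trans ?_
    exact congrFun t.1.2 v⟩

theorem paramSub_bij {U V : QRep Q k} {γ : Q.V → ℕ} {z : Cochain U V} :
    Function.Bijective (paramSub (U := U) (V := V) (γ := γ) (z := z)) := by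
  constructor
  · rintro ⟨⟨⟨U1, V1⟩, hp⟩, ⟨φ, hφ⟩⟩ ⟨⟨⟨U2, V2⟩, hp'⟩, ⟨ψ, hψ⟩⟩ h
    have hv : ∀ v, gsub (V1.sub v) (U1.sub v) (φ v) = gsub (V2.sub v) (U2.sub v) (ψ v) :=
      fun v => congrFun (congrArg (fun L => SubRep.sub (Subtype.val L)) h) v
    obtain rfl : U1 = U2 := SubRep.ext' fun v => by
      have := congrArg (Submodule.map (LinearMap.snd k _ _)) (hv v)
      exact ((gsub_map _ _ _).symm.trans this).trans (gsub_map _ _ _)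
    obtain rfl : V1 = V2 := SubRep.ext' fun v => by
      have := congrArg (Submodule.comap (LinearMap.inl k _ _)) (hv v)
      exact ((gsub_comap _ _ _).symm.trans this).trans (gsub_comap _ _ _)
    obtain rfl : φ = ψ := funext fun v => gsub_inj (hv v)
    rfl
  · rintro ⟨L, hL⟩
    let U1 : SubRep U := ⟨fun v => (L.sub v).map (LinearMap.snd k (V.space v) (U.space v)), by
      rintro a _ ⟨x, hx, rfl⟩
      exact ⟨_, L.stable a x hx, rfl⟩⟩
    let V1 : SubRep V := ⟨fun v => (L.sub v).comap (LinearMap.inl k (V.space v) (U.space v)), by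
      intro a x hx
      have h := L.stable a (x, 0) hx
      have e : (middle z).map a (x, 0) = (V.map a x, 0) := by
        apply Prod.ext
        · change V.map a x + z a 0 = _
          rw [map_zero, add_zero]
        · exact map_zero (U.map a)
      rw [e] at h
      exact h⟩
    have hφ : ∀ v, ∃ φ : U1.sub v →ₗ[k] V.space v ⧸ V1.sub v,
        gsub (V1.sub v) (U1.sub v) φ = L.sub v := fun v => gsub_surj (L.sub v)
    choose φ hφ using hφ
    have hd : U1.dim + V1.dim = γ := by
      rw [← hL]
      funext v
      refine (gsub_finrank (V1.sub v) (U1.sub v) (φ v)).symm.trans ?_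
      rw [hφ]
      rfl
    have hc : res U1 V1 z = - coboundary (U := U1.toRep) (V := V1.quotRep) φ := by
      rw [res_eq_iff]
      intro a x hx
      rw [hφ] at hx ⊢
      exact L.stable a x hx
    exact ⟨⟨⟨(U1, V1), hd⟩, ⟨φ, hc⟩⟩, Subtype.ext (SubRep.ext' hφ)⟩

section Fin2
variable [Fintype k]

theorem card_cochain (U V : QRep Q k) :
    (Nat.card (Cochain U V) : ℚ) =
      (Fintype.card k : ℚ) ^ (∑ a, (U.dimVec (Q.src a) : ℤ) * (V.dimVec (Q.tgt a) : ℤ)) := by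
  have h : Nat.card (Cochain U V) =
      (Fintype.card k) ^ (∑ a, U.dimVec (Q.src a) * V.dimVec (Q.tgt a)) := by
    rw [Nat.card_pi, ← Finset.prod_pow_eq_pow_sum]
    refine Finset.prod_congr rfl fun a _ => ?_
    rw [Module.natCard_eq_pow_finrank (K := k), Module.finrank_linearMap,
      Nat.card_eq_fintype_card]
    rfl
  rw [h]
  push_cast
  rw [← zpow_natCast]
  push_cast
  rfl

theorem card_fam (U V : QRep Q k) :
    (Nat.card (∀ v, U.space v →ₗ[k] V.space v) : ℚ) =
      (Fintype.card k : ℚ) ^ (∑ v, (U.dimVec v : ℤ) * (V.dimVec v : ℤ)) := by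
  have h : Nat.card (∀ v, U.space v →ₗ[k] V.space v) =
      (Fintype.card k) ^ (∑ v, U.dimVec v * V.dimVec v) := by
    rw [Nat.card_pi, ← Finset.prod_pow_eq_pow_sum]
    refine Finset.prod_congr rfl fun a _ => ?_
    rw [Module.natCard_eq_pow_finrank (K := k), Module.finrank_linearMap,
      Nat.card_eq_fintype_card]
    rfl
  rw [h]
  push_cast
  rw [← zpow_natCast]
  push_cast
  rfl

theorem quot_dim {V : QRep Q k} (V1 : SubRep V) : V1.quotRep.dimVec = V.dimVec - V1.dim := by
  funext v
  exact Submodule.finrank_quotient (V1.sub v)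

theorem sum_middle (U V : QRep Q k) (γ : Q.V → ℕ) [Fintype (Cochain U V)]
    [Fintype (SubRep U)] [Fintype (SubRep V)] :
    ∑ z : Cochain U V, (grCard γ (middle z) : ℚ) =
      (∑ p : SubRep U × SubRep V, if p.1.dim + p.2.dim = γ then
        (Fintype.card k : ℚ) ^ eulerFormN Q p.1.dim (V.dimVec - p.2.dim) else 0) *
      (Fintype.card (Cochain U V) : ℚ) := by
  have hq : (Fintype.card k : ℚ) ≠ 0 := by
    exact_mod_cast Fintype.card_ne_zero
  have h1 : ∀ z : Cochain U V, (grCard γ (middle z) : ℚ) =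
      ∑ p : {p : SubRep U × SubRep V // p.1.dim + p.2.dim = γ},
        (Nat.card {φ : ∀ v, p.1.1.toRep.space v →ₗ[k] p.1.2.quotRep.space v //
          res p.1.1 p.1.2 z = - coboundary φ} : ℚ) := by
    intro z
    rw [grCard, ← Nat.card_congr (Equiv.ofBijective _ paramSub_bij), Nat.card_sigma]
    push_cast
    rfl
  simp only [h1]
  rw [Finset.sum_comm, ← Finset.sum_filter, Finset.sum_mul,
    ← Finset.sum_subtype_eq_sum_filter]
  rw [Finset.subtype_univ]
  refine Finset.sum_congr rfl ?_
  rintro ⟨⟨U1, V1⟩, hp⟩ -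
  have := Fintype.ofFinite (∀ v, U1.toRep.space v →ₗ[k] V1.quotRep.space v)
  simp only [natCard_sub]
  rw [Finset.sum_comm]
  have h2 : ∀ φ : (∀ v, U1.toRep.space v →ₗ[k] V1.quotRep.space v),
      (∑ z, @ite ℚ (res U1 V1 z = - coboundary φ) (Classical.propDecidable _) 1 0) =
      (Fintype.card (Cochain U V) : ℚ) / (Nat.card (Cochain U1.toRep V1.quotRep) : ℚ) := by
    intro φ
    rw [← natCard_sub, eq_div_iff, ← Nat.card_eq_fintype_card,
      ← res_fiber U1 V1 (- coboundary φ)]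
    · push_cast; rfl
    · exact_mod_cast Nat.card_pos.ne'
  simp only [h2]
  rw [Finset.sum_const, Finset.card_univ, nsmul_eq_mul, ← Nat.card_eq_fintype_card, card_fam,
    card_cochain U1.toRep, quot_dim]
  change _ = (Fintype.card k : ℚ) ^ ((∑ v, ((U1.dim v : ℕ) : ℤ) * (((V.dimVec - V1.dim) v : ℕ) : ℤ))
    - ∑ a, ((U1.dim (Q.src a) : ℕ) : ℤ) * (((V.dimVec - V1.dim) (Q.tgt a) : ℕ) : ℤ)) * _
  rw [zpow_sub₀ hq]
  change (Fintype.card k : ℚ) ^ (∑ v, ((U1.dim v : ℕ) : ℤ) * (((V.dimVec - V1.dim) v : ℕ) : ℤ)) *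
    (_ / (Fintype.card k : ℚ) ^ 
      (∑ a, ((U1.dim (Q.src a) : ℕ) : ℤ) * (((V.dimVec - V1.dim) (Q.tgt a) : ℕ) : ℤ))) = _
  ring

theorem lhs_eq (U V : QRep Q k) (γ : Q.V → ℕ) [Fintype (SubRep U)] [Fintype (SubRep V)]
    (E : (Q.V → ℕ) → (Q.V → ℕ) → ℚ) :
    (∑ᶠ (γ₁ : Q.V → ℕ) (γ₂ : Q.V → ℕ),
      if γ₁ + γ₂ = γ then E γ₁ γ₂ * (grCard γ₁ U : ℚ) * (grCard γ₂ V : ℚ) else 0) =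
    ∑ p : SubRep U × SubRep V, if p.1.dim + p.2.dim = γ then E p.1.dim p.2.dim else 0 := by
  have inner : ∀ γ₁ : Q.V → ℕ, (∑ᶠ (γ₂ : Q.V → ℕ),
      if γ₁ + γ₂ = γ then E γ₁ γ₂ * (grCard γ₁ U : ℚ) * (grCard γ₂ V : ℚ) else 0) =
      ∑ γ₂ ∈ Finset.Iic γ,
      if γ₁ + γ₂ = γ then E γ₁ γ₂ * (grCard γ₁ U : ℚ) * (grCard γ₂ V : ℚ) else 0 := by
    intro γ₁
    apply finsum_eq_sum_of_support_subset
    intro γ₂ h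
    rw [Function.mem_support] at h
    have h' : γ₁ + γ₂ = γ := by
      by_contra hne
      exact h (if_neg hne)
    rw [Finset.mem_coe, Finset.mem_Iic, ← h']
    exact le_add_self
  simp only [inner]
  rw [finsum_eq_sum_of_support_subset (s := Finset.Iic γ)]
  · have hg : ∀ γ₁ γ₂, (if γ₁ + γ₂ = γ then
        E γ₁ γ₂ * (grCard γ₁ U : ℚ) * (grCard γ₂ V : ℚ) else 0) =
        ∑ p : SubRep U × SubRep V,
          if p.1.dim = γ₁ then (if p.2.dim = γ₂ then
            (if γ₁ + γ₂ = γ then E γ₁ γ₂ else 0) else 0) else 0 := by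
      intro γ₁ γ₂
      rw [Fintype.sum_prod_type]
      split_ifs with h
      · rw [grCard, grCard, natCard_sub, natCard_sub, mul_assoc, Finset.sum_mul_sum,
          Finset.mul_sum]
        refine Finset.sum_congr rfl fun U1 _ => ?_
        rw [Finset.mul_sum]
        refine Finset.sum_congr rfl fun V1 _ => ?_
        split_ifs <;> simp
      · simp
    simp only [hg]
    have hsw : ∀ γ₁, (∑ γ₂ ∈ Finset.Iic γ, ∑ p : SubRep U × SubRep V,
          if p.1.dim = γ₁ then (if p.2.dim = γ₂ then
            (if γ₁ + γ₂ = γ then E γ₁ γ₂ else 0) else 0) else 0) =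
        ∑ p : SubRep U × SubRep V, ∑ γ₂ ∈ Finset.Iic γ,
          if p.1.dim = γ₁ then (if p.2.dim = γ₂ then
            (if γ₁ + γ₂ = γ then E γ₁ γ₂ else 0) else 0) else 0 :=
      fun γ₁ => Finset.sum_comm
    simp only [hsw]
    rw [Finset.sum_comm]
    refine Finset.sum_congr rfl fun p _ => ?_
    by_cases hp : p.1.dim + p.2.dim = γ
    · have m1 : p.1.dim ∈ Finset.Iic γ := by
        rw [Finset.mem_Iic, ← hp]; exact le_self_add
      have m2 : p.2.dim ∈ Finset.Iic γ := by
        rw [Finset.mem_Iic, ← hp]; exact le_add_self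
      rw [if_pos hp, Finset.sum_eq_single_of_mem _ m1, Finset.sum_eq_single_of_mem _ m2]
      · rw [if_pos rfl, if_pos rfl, if_pos hp]
      · intro b _ hb
        rw [if_pos rfl, if_neg hb.symm]
      · intro b _ hb
        simp only [if_neg hb.symm, Finset.sum_const_zero]
    · rw [if_neg hp]
      refine Finset.sum_eq_zero fun a _ => Finset.sum_eq_zero fun b _ => ?_
      split_ifs with h1 h2 h3
      · subst h1 h2; exact absurd h3 hp
      · rfl
      · rfl
      · rfl
  · intro γ₁ h
    rw [Function.mem_support] at h
    obtain ⟨γ₂, _, h2⟩ := Finset.exists_ne_zero_of_sum_ne_zero h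
    have h' : γ₁ + γ₂ = γ := by
      by_contra hne
      exact h2 (if_neg hne)
    rw [Finset.mem_coe, Finset.mem_Iic, ← h']
    exact le_self_add

end Fin2

end QRep

end Helpers

/-- the Grassmannian identity obtained from the character
`∫_Δ = (∫⊗∫)∘Δ`: for all `U, V` with `dim U = α₁`, `dim V = α₂` and every
dimension vector `γ`,
`∑_{γ₁+γ₂=γ} q^{⟨γ₁,α₂-γ₂⟩_a} |Gr_{γ₁}(U)||Gr_{γ₂}(V)|
  = ∑_{[W]} (|Ext(U,V)_W|/|Ext¹(U,V)|) |Gr_γ(W)|`. -/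
theorem statement5 (Q : FinQuiver) (k : Type) [Field k] [Fintype k]
    (U V : QRep Q k) (α₁ α₂ : Q.V → ℕ)
    (hU : U.dimVec = α₁) (hV : V.dimVec = α₂) (γ : Q.V → ℕ) :
    (∑ᶠ (γ₁ : Q.V → ℕ) (γ₂ : Q.V → ℕ),
      if γ₁ + γ₂ = γ then
        ((Fintype.card k : ℚ) ^ eulerFormN Q γ₁ (α₂ - γ₂)) *
          (grCard γ₁ U : ℚ) * (grCard γ₂ V : ℚ)
      else 0) =
    ∑ᶠ c : IsoClass Q k (α₁ + α₂),
      ((extWCard U V c.rep : ℚ) / (ext1Card U V : ℚ)) *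
        (grCard γ c.rep : ℚ) := by
  subst hU hV
  have := Fintype.ofFinite (Cochain U V)
  have := Fintype.ofFinite (SubRep U)
  have := Fintype.ofFinite (SubRep V)
  rw [rhs_eq, sum_middle, mul_div_cancel_right₀]
  · exact lhs_eq U V γ
      (fun γ₁ γ₂ => (Fintype.card k : ℚ) ^ eulerFormN Q γ₁ (V.dimVec - γ₂))
  · exact_mod_cast Fintype.card_ne_zero

end HallPaper
end

section
/- Let alpha be a dimension vector of a finite quiver Q, and let gamma <= alpha with beta = alpha - gamma. Then the sum over isomorphism classes [M] of representations of Q over F_q with dim M = alpha of |Gr_gamma(M)| / a_M equals q^{-<beta,gamma>_a} * r_beta(q) * r_gamma(q). -/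
/- Common setup: finite quivers, finite-dimensional representations over a
finite field, subrepresentations, quotients, Hall numbers, quiver
Grassmannians and flags, extensions, and the (completed) Hall algebra,
following J. Fei, "Counting using Hall algebras I. Quivers". -/

open scoped BigOperators

attribute [local instance] Classical.propDecidable

namespace HallPaper

open QRep

section LinAlg

/-- The number of linear maps carrying one subspace into another. -/
theorem card_hom_preserving {k V W : Type} [Field k] [Fintype k]
    [AddCommGroup V] [Module k V] [FiniteDimensional k V]
    [AddCommGroup W] [Module k W] [FiniteDimensional k W]
    (U : Submodule k V) (U' : Submodule k W) (a b c d : ℕ)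
    (hV : Module.finrank k V = a + b) (hU : Module.finrank k U = a)
    (hW : Module.finrank k W = c + d) (hU' : Module.finrank k U' = c) :
    Nat.card {f : V →ₗ[k] W // ∀ x ∈ U, f x ∈ U'} =
      Fintype.card k ^ (a * c + b * c + b * d) := by
  let T : (V →ₗ[k] W) →ₗ[k] (U →ₗ[k] (W ⧸ U')) :=
    { toFun := fun f => (U'.mkQ).comp (f.comp U.subtype)
      map_add' := fun f g => by ext x; simp
      map_smul' := fun r f => by ext x; simp }
  have hT : Function.Surjective T := by
    intro g
    obtain ⟨h, hh⟩ := Module.projective_lifting_property U'.mkQ g (Submodule.mkQ_surjective U')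
    obtain ⟨f, hf⟩ := LinearMap.exists_extend h
    exact ⟨f, by change (U'.mkQ).comp (f.comp U.subtype) = g; rw [hf, hh]⟩
  have hker : ∀ f, f ∈ LinearMap.ker T ↔ ∀ x ∈ U, f x ∈ U' := by
    intro f
    rw [LinearMap.mem_ker]
    constructor
    · intro h x hx
      have := LinearMap.congr_fun h ⟨x, hx⟩
      simpa [T] using this
    · intro h
      ext x
      simpa [T] using h x x.2
  have e : {f : V →ₗ[k] W // ∀ x ∈ U, f x ∈ U'} ≃ LinearMap.ker T :=
    Equiv.subtypeEquivRight (fun f => (hker f).symm)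
  rw [Nat.card_congr e, Module.natCard_eq_pow_finrank (K := k), Nat.card_eq_fintype_card]
  congr 1
  have h1 := LinearMap.finrank_range_add_finrank_ker T
  rw [LinearMap.range_eq_top.2 hT, finrank_top, Module.finrank_linearMap,
    Module.finrank_linearMap] at h1
  have h2 := Submodule.finrank_quotient_add_finrank U'
  have h3 : Module.finrank k (W ⧸ U') = d := by omega
  rw [h3, hU, hV, hW] at h1
  nlinarith

/-- The number of block triangular automorphisms. -/
theorem card_triangular {k A B : Type} [Field k] [Fintype k]
    [AddCommGroup A] [Module k A] [FiniteDimensional k A]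
    [AddCommGroup B] [Module k B] [FiniteDimensional k B] :
    Nat.card {t : (B × A) ≃ₗ[k] (B × A) // ∀ x : A, (t (0, x)).1 = 0} =
      Nat.card (A ≃ₗ[k] A) * Nat.card (B ≃ₗ[k] B) * Nat.card (B →ₗ[k] A) := by
  let F : (A ≃ₗ[k] A) × (B ≃ₗ[k] B) × (B →ₗ[k] A) →
      {t : (B × A) ≃ₗ[k] (B × A) // ∀ x : A, (t (0, x)).1 = 0} := fun p =>
    ⟨LinearEquiv.skewProd p.2.1 p.1 p.2.2, fun x => by simp⟩
  have hF : Function.Bijective F := by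
    constructor
    · rintro ⟨g, h, f⟩ ⟨g', h', f'⟩ hp
      have hp' : ∀ z : B × A, (h z.1, g z.2 + f z.1) = (h' z.1, g' z.2 + f' z.1) := by
        intro z
        have := congrArg (fun t => t.1 z) hp
        simpa [F] using this
      have h1 : h = h' := by
        ext y; have := hp' (y, 0); simp at this; exact this.1
      have h2 : g = g' := by
        ext y; have := hp' (0, y); simpa using this
      have h3 : f = f' := by
        ext y; have := hp' (y, 0); simp at this; exact this.2
      rw [h1, h2, h3]
    · rintro ⟨t, ht⟩
      have hg : Function.Injective
          (((LinearMap.snd k B A).comp t.toLinearMap).comp (LinearMap.inr k B A)) := by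
        rw [injective_iff_map_eq_zero]
        intro x hx
        have h0 : t (0, x) = 0 := Prod.ext (ht x) (by simpa using hx)
        have h1 : ((0 : B), x) = 0 := t.map_eq_zero_iff.1 h0
        exact congrArg Prod.snd h1
      let g := LinearEquiv.ofInjectiveEndo _ hg
      have hgx : ∀ x, t (0, x) = (0, g x) := fun x => Prod.ext (ht x) rfl
      have hh : Function.Injective
          (((LinearMap.fst k B A).comp t.toLinearMap).comp (LinearMap.inl k B A)) := by
        rw [injective_iff_map_eq_zero]
        intro y hy
        have h1 : t (y, 0) = t (0, g.symm (t (y, 0)).2) := by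
          rw [hgx]
          exact Prod.ext (by simpa using hy) (by simp)
        have h2 := t.injective h1
        exact congrArg Prod.fst h2
      let h := LinearEquiv.ofInjectiveEndo _ hh
      refine ⟨(g, h, ((LinearMap.snd k B A).comp t.toLinearMap).comp (LinearMap.inl k B A)), ?_⟩
      apply Subtype.ext
      apply LinearEquiv.ext
      rintro ⟨y, x⟩
      have hs : t (y, x) = t (y, 0) + t (0, x) := by rw [← map_add]; simp
      rw [hs, hgx]
      refine Prod.ext ?_ ?_
      · simp [F, h]
      · simp [F, add_comm]
  rw [← Nat.card_congr (Equiv.ofBijective F hF), Nat.card_prod, Nat.card_prod, mul_assoc]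

/-- The number of subspaces of a given dimension, in product form. -/
theorem card_grass {k A B V : Type} [Field k] [Fintype k]
    [AddCommGroup A] [Module k A] [FiniteDimensional k A]
    [AddCommGroup B] [Module k B] [FiniteDimensional k B]
    [AddCommGroup V] [Module k V] [FiniteDimensional k V]
    (hV : Module.finrank k V = Module.finrank k A + Module.finrank k B) :
    Nat.card {U : Submodule k V // Module.finrank k U = Module.finrank k A} *
      (Nat.card (A ≃ₗ[k] A) * Nat.card (B ≃ₗ[k] B) * Nat.card (B →ₗ[k] A)) =
      Nat.card (V ≃ₗ[k] V) := by
  have : Finite V := Module.finite_of_finite k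
  have : Finite A := Module.finite_of_finite k
  have : Finite B := Module.finite_of_finite k
  have : Finite (Submodule k V) := inferInstance
  have finE : Finite ((B × A) ≃ₗ[k] V) :=
    Finite.of_injective (fun e => (e : (B × A) → V)) DFunLike.coe_injective
  have hr : ∀ e : (B × A) ≃ₗ[k] V,
      Module.finrank k (LinearMap.range (e.toLinearMap.comp (LinearMap.inr k B A))) =
        Module.finrank k A := by
    intro e
    apply LinearMap.finrank_range_of_inj
    intro x y hxy
    have := e.injective hxy
    exact congrArg Prod.snd this
  let R : ((B × A) ≃ₗ[k] V) → {U : Submodule k V // Module.finrank k U = Module.finrank k A} :=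
    fun e => ⟨LinearMap.range (e.toLinearMap.comp (LinearMap.inr k B A)), hr e⟩
  have hfib : ∀ U, Nat.card {e // R e = U} =
      Nat.card (A ≃ₗ[k] A) * Nat.card (B ≃ₗ[k] B) * Nat.card (B →ₗ[k] A) := by
    rintro ⟨U, hU⟩
    obtain ⟨C, hC⟩ := Submodule.exists_isCompl U
    have hdim := Submodule.finrank_add_eq_of_isCompl hC
    let eA : A ≃ₗ[k] U := LinearEquiv.ofFinrankEq _ _ hU.symm
    let eB : B ≃ₗ[k] C := LinearEquiv.ofFinrankEq _ _ (by omega)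
    let e0 : (B × A) ≃ₗ[k] V :=
      (eB.prodCongr eA).trans (Submodule.prodEquivOfIsCompl C U hC.symm)
    have he0 : ∀ x, e0 (0, x) = eA x := by
      intro x; simp [e0]
    have hmem : ∀ z, e0 z ∈ U ↔ z.1 = 0 := by
      rintro ⟨y, x⟩
      have h1 : e0 (y, x) = eB y + eA x := by simp [e0]
      rw [h1]
      constructor
      · intro h
        have h2 : (eB y : V) ∈ U := by
          have := U.sub_mem h (eA x).2
          simpa using this
        have h3 : (eB y : V) = 0 := by
          have := Submodule.disjoint_def.1 hC.disjoint _ h2 (eB y).2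
          exact this
        have h4 : eB y = 0 := Subtype.ext h3
        exact eB.map_eq_zero_iff.1 h4
      · intro h
        simp only at h
        subst h
        simp
    have hiff : ∀ e : (B × A) ≃ₗ[k] V, R e = ⟨U, hU⟩ ↔ ∀ x : A, (e0.symm (e (0, x))).1 = 0 := by
      intro e
      rw [Subtype.ext_iff]
      constructor
      · intro h x
        rw [← hmem, LinearEquiv.apply_symm_apply]
        have : e (0, x) ∈ (R e).1 := ⟨x, rfl⟩
        rw [h] at this
        exact this
      · intro h
        apply Submodule.eq_of_le_of_finrank_eq
        · rintro _ ⟨x, rfl⟩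
          have := (hmem _).2 (h x)
          rw [LinearEquiv.apply_symm_apply] at this
          exact this
        · rw [hU]; exact hr e
    rw [← card_triangular]
    refine Nat.card_congr
      { toFun := fun e => ⟨e.1.trans e0.symm, (hiff e.1).1 e.2⟩
        invFun := fun t => ⟨t.1.trans e0, (hiff _).2 (fun x => by simpa using t.2 x)⟩
        left_inv := fun e => by apply Subtype.ext; ext x <;> simp
        right_inv := fun t => by
          apply Subtype.ext; apply LinearEquiv.ext; intro x; simp }
  have e1 : (B × A) ≃ₗ[k] V :=
    LinearEquiv.ofFinrankEq _ _ (by rw [Module.finrank_prod, hV, add_comm])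
  have hE : Nat.card ((B × A) ≃ₗ[k] V) = Nat.card (V ≃ₗ[k] V) :=
    Nat.card_congr
      { toFun := fun e => e1.symm.trans e
        invFun := fun e => e1.trans e
        left_inv := fun e => by apply LinearEquiv.ext; intro x; simp
        right_inv := fun e => by apply LinearEquiv.ext; intro x; simp }
  rw [← hE, ← Nat.card_congr (Equiv.sigmaFiberEquiv R)]
  letI := Fintype.ofFinite {U : Submodule k V // Module.finrank k U = Module.finrank k A}
  rw [Nat.card_sigma, Finset.sum_congr rfl (fun U _ => hfib U), Finset.sum_const,
    Nat.card_eq_fintype_card, smul_eq_mul, Finset.card_univ]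

theorem card_gl_eq {k : Type} [Field k] (n : ℕ) :
    Nat.card (Matrix.GeneralLinearGroup (Fin n) k) =
      Nat.card ((Fin n → k) ≃ₗ[k] (Fin n → k)) :=
  Nat.card_congr (Matrix.GeneralLinearGroup.toLin.trans
    (LinearMap.GeneralLinearGroup.generalLinearEquiv k (Fin n → k))).toEquiv

/-- Grassmannian count in `k^n`. -/
theorem card_grass_std {k : Type} [Field k] [Fintype k] (n a b : ℕ) (h : n = a + b) :
    Nat.card {U : Submodule k (Fin n → k) // Module.finrank k U = a} *
      (Nat.card (Matrix.GeneralLinearGroup (Fin a) k) *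
        Nat.card (Matrix.GeneralLinearGroup (Fin b) k) * Fintype.card k ^ (b * a)) =
      Nat.card (Matrix.GeneralLinearGroup (Fin n) k) := by
  have := card_grass (k := k) (A := Fin a → k) (B := Fin b → k) (V := Fin n → k) (by simpa using h)
  rw [card_gl_eq, card_gl_eq, card_gl_eq, ← this,
    Module.natCard_eq_pow_finrank (K := k) (V := (Fin b → k) →ₗ[k] (Fin a → k)),
    Module.finrank_linearMap]
  simp

end LinAlg

section QuiverCount

variable {Q : FinQuiver} {k : Type} [Field k]

/-- Identity isomorphism. -/
def isoRefl (M : QRep Q k) : Iso M M := ⟨fun _ => LinearEquiv.refl k _, fun _ _ => rfl⟩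

theorem isoRel_equivalence (α : Q.V → ℕ) : Equivalence (isoRel Q k α) :=
  ⟨fun W => ⟨isoRefl _⟩, fun ⟨f⟩ => ⟨isoSymm f⟩, fun ⟨f⟩ ⟨g⟩ => ⟨isoTrans f g⟩⟩

theorem card_iso_of_iso {M N : QRep Q k} (f : Iso M N) : Nat.card (Iso M N) = autCard M :=
  Nat.card_congr
    { toFun := fun g => isoTrans g (isoSymm f)
      invFun := fun g => isoTrans g f
      left_inv := fun g => by apply Iso.ext_app; intro v x; simp [isoTrans, isoSymm]
      right_inv := fun g => by apply Iso.ext_app; intro v x; simp [isoTrans, isoSymm] }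

/-- Image of a subrepresentation under an isomorphism. -/
def subMap {M N : QRep Q k} (f : Iso M N) (L : SubRep M) : SubRep N where
  sub := fun v => (L.sub v).map (f.app v).toLinearMap
  stable := by
    rintro a _ ⟨x, hx, rfl⟩
    exact ⟨M.map a x, L.stable a x hx, f.comm a x⟩

theorem subMap_dim {M N : QRep Q k} (f : Iso M N) (L : SubRep M) : (subMap f L).dim = L.dim := by
  funext v
  exact LinearEquiv.finrank_map_eq (f.app v) (L.sub v)

theorem subMap_symm {M N : QRep Q k} (f : Iso M N) (L : SubRep M) :
    subMap (isoSymm f) (subMap f L) = L := by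
  apply SubRep.ext_sub
  intro v
  ext x
  simp [subMap, isoSymm]

theorem subMap_symm' {M N : QRep Q k} (f : Iso M N) (L : SubRep N) :
    subMap f (subMap (isoSymm f) L) = L := by
  apply SubRep.ext_sub
  intro v
  ext x
  simp [subMap, isoSymm]

theorem grCard_congr {M N : QRep Q k} (γ : Q.V → ℕ) (f : Iso M N) : grCard γ M = grCard γ N :=
  Nat.card_congr
    { toFun := fun L => ⟨subMap f L.1, by rw [subMap_dim, L.2]⟩
      invFun := fun L => ⟨subMap (isoSymm f) L.1, by rw [subMap_dim, L.2]⟩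
      left_inv := fun L => Subtype.ext (subMap_symm f L.1)
      right_inv := fun L => Subtype.ext (subMap_symm' f L.1) }

variable [Fintype k]

theorem finite_iso {α : Q.V → ℕ} (W W' : StdRep Q k α) : Finite (Iso W.toQRep W'.toQRep) := by
  refine Finite.of_injective
    (β := ∀ v, (Fin (α v) → k) → (Fin (α v) → k))
    (fun f : Iso W.toQRep W'.toQRep => fun v x => f.app v x) ?_
  intro f g h
  apply Iso.ext_app
  intro v x
  exact congrFun (congrFun h v) x

theorem finite_sub {α : Q.V → ℕ} (W : StdRep Q k α) : Finite (SubRep W.toQRep) := by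
  refine Finite.of_injective
    (fun L : SubRep W.toQRep => fun v => (show Submodule k (Fin (α v) → k) from L.sub v)) ?_
  intro f g h
  exact SubRep.ext_sub (fun v => congrFun h v)

/-- Action of a family of linear automorphisms on a point of `Rep_α`. -/
noncomputable def actOn {α : Q.V → ℕ} (W : StdRep Q k α)
    (g : ∀ v, (Fin (α v) → k) ≃ₗ[k] (Fin (α v) → k)) : StdRep Q k α :=
  fun a => LinearMap.toMatrix' (((g (Q.tgt a)).toLinearMap.comp (Matrix.mulVecLin (W a))).comp
    (g (Q.src a)).symm.toLinearMap)

theorem actOn_eq_iff {α : Q.V → ℕ} (W W' : StdRep Q k α)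
    (g : ∀ v, (Fin (α v) → k) ≃ₗ[k] (Fin (α v) → k)) :
    actOn W g = W' ↔ ∀ (a : Q.A) (x : Fin (α (Q.src a)) → k),
      g (Q.tgt a) ((W a).mulVec x) = (W' a).mulVec (g (Q.src a) x) := by
  constructor
  · rintro rfl a x
    rw [← Matrix.toLin'_apply (actOn W g a)]
    simp [actOn]
  · intro h
    funext a
    apply Matrix.toLin'.injective
    apply LinearMap.ext
    intro x
    have := h a ((g (Q.src a)).symm x)
    rw [LinearEquiv.apply_symm_apply] at this
    rw [Matrix.toLin'_apply (W' a), ← this]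
    simp [actOn]

theorem glCard_eq (α : Q.V → ℕ) :
    glCard Q k α = Nat.card (∀ v, (Fin (α v) → k) ≃ₗ[k] (Fin (α v) → k)) := by
  unfold glCard
  rw [Nat.card_pi, Nat.card_pi]
  exact Finset.prod_congr rfl (fun v _ => card_gl_eq _)

theorem glCard_pos (α : Q.V → ℕ) : 0 < glCard Q k α := by
  unfold glCard
  exact Nat.card_pos

/-- Orbit counting. -/
theorem sum_iso_card {α : Q.V → ℕ} [Fintype (StdRep Q k α)] (W : StdRep Q k α) :
    ∑ W' : StdRep Q k α, Nat.card (Iso W.toQRep W'.toQRep) = glCard Q k α := by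
  have : ∀ v, Finite ((Fin (α v) → k) ≃ₗ[k] (Fin (α v) → k)) := fun v =>
    Finite.of_injective (fun e => (e : (Fin (α v) → k) → _)) DFunLike.coe_injective
  rw [glCard_eq, ← Nat.card_congr (Equiv.sigmaFiberEquiv (actOn W)), Nat.card_sigma]
  refine Finset.sum_congr rfl (fun W' _ => Nat.card_congr ?_)
  exact
    { toFun := fun f => ⟨f.app, (actOn_eq_iff W W' f.app).2 f.comm⟩
      invFun := fun g => ⟨g.1, (actOn_eq_iff W W' g.1).1 g.2⟩
      left_inv := fun f => rfl
      right_inv := fun g => rfl }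

theorem autCard_pos {α : Q.V → ℕ} (W : StdRep Q k α) : 0 < autCard W.toQRep := by
  have := finite_iso W W
  have : Nonempty (Iso W.toQRep W.toQRep) := ⟨isoRefl _⟩
  exact Nat.card_pos

theorem sum_classes (α γ : Q.V → ℕ) [Fintype (StdRep Q k α)] :
    (∑ᶠ c : IsoClass Q k α, (grCard γ c.rep : ℚ) / (autCard c.rep : ℚ)) * (glCard Q k α : ℚ) =
      ((∑ W : StdRep Q k α, grCard γ W.toQRep : ℕ) : ℚ) := by
  have : Finite (IsoClass Q k α) := Quot.finite _
  let _ := Fintype.ofFinite (IsoClass Q k α)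
  rw [finsum_eq_sum_of_fintype, Finset.sum_mul]
  let p : StdRep Q k α → IsoClass Q k α := Quot.mk _
  push_cast
  rw [← Finset.sum_fiberwise Finset.univ p]
  refine Finset.sum_congr rfl (fun c _ => ?_)
  let W0 : StdRep Q k α := Quot.out c
  have hc : p W0 = c := Quot.out_eq c
  have hp : ∀ W, p W = c ↔ Nonempty (Iso W0.toQRep W.toQRep) := by
    intro W
    rw [← hc, eq_comm]
    exact (isoRel_equivalence α).quot_mk_eq_iff W0 W
  have h1 : ∀ W ∈ Finset.univ.filter (fun W => p W = c),
      (grCard γ W.toQRep : ℚ) = grCard γ W0.toQRep := by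
    intro W hW
    obtain ⟨f⟩ := (hp W).1 (Finset.mem_filter.1 hW).2
    rw [grCard_congr γ f]
  have h2 : glCard Q k α = (Finset.univ.filter (fun W => p W = c)).card * autCard W0.toQRep := by
    rw [← sum_iso_card W0, ← smul_eq_mul, ← Finset.sum_const, Finset.sum_filter]
    refine Finset.sum_congr rfl (fun W _ => ?_)
    split_ifs with h
    · obtain ⟨f⟩ := (hp W).1 h
      exact card_iso_of_iso f
    · have : IsEmpty (Iso W0.toQRep W.toQRep) := by
        rw [hp] at h
        exact not_nonempty_iff.1 h
      exact Nat.card_of_isEmpty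
  rw [Finset.sum_congr rfl h1, Finset.sum_const, nsmul_eq_mul, h2]
  change (grCard γ W0.toQRep : ℚ) / (autCard W0.toQRep : ℚ) * _ = _
  have h3 : (autCard W0.toQRep : ℚ) ≠ 0 := by exact_mod_cast (autCard_pos W0).ne'
  push_cast
  field_simp

theorem sigma_sub_ext {α γ : Q.V → ℕ} {W W' : StdRep Q k α} (h : W = W')
    (L : {L : SubRep W.toQRep // L.dim = γ}) (L' : {L : SubRep W'.toQRep // L.dim = γ})
    (hs : ∀ v, (show Submodule k (Fin (α v) → k) from L.1.sub v) = L'.1.sub v) :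
    (⟨W, L⟩ : Σ W : StdRep Q k α, {L : SubRep W.toQRep // L.dim = γ}) = ⟨W', L'⟩ := by
  subst h
  have : L = L' := Subtype.ext (SubRep.ext_sub hs)
  rw [this]

theorem sum_grCard (α γ : Q.V → ℕ) (hle : γ ≤ α) [Fintype (StdRep Q k α)] :
    ∑ W : StdRep Q k α, grCard γ W.toQRep =
      (∏ v, Nat.card {U : Submodule k (Fin (α v) → k) // Module.finrank k U = γ v}) *
      ∏ a : Q.A, Fintype.card k ^ (γ (Q.src a) * γ (Q.tgt a) +
        (α - γ) (Q.src a) * γ (Q.tgt a) + (α - γ) (Q.src a) * (α - γ) (Q.tgt a)) := by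
  have hfs := fun W : StdRep Q k α => finite_sub W
  unfold grCard
  rw [← Nat.card_sigma]
  let Fam := ∀ v, {U : Submodule k (Fin (α v) → k) // Module.finrank k U = γ v}
  let S : Fam → Type := fun U => ∀ a : Q.A,
    {f : (Fin (α (Q.src a)) → k) →ₗ[k] (Fin (α (Q.tgt a)) → k) //
      ∀ x ∈ (U (Q.src a)).1, f x ∈ (U (Q.tgt a)).1}
  have e : (Σ W : StdRep Q k α, {L : SubRep W.toQRep // L.dim = γ}) ≃ Σ U : Fam, S U :=
    { toFun := fun p => ⟨fun v => ⟨p.2.1.sub v, congrFun p.2.2 v⟩,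
        fun a => ⟨Matrix.toLin' (p.1 a), fun x hx => p.2.1.stable a x hx⟩⟩
      invFun := fun p => ⟨fun a => LinearMap.toMatrix' (p.2 a).1,
        ⟨⟨fun v => (p.1 v).1, fun a x hx => by
            have := (p.2 a).2 x hx
            have h2 := LinearMap.toMatrix'_mulVec (p.2 a).1 x
            exact (congrArg (fun y => y ∈ (p.1 (Q.tgt a)).1) h2).mpr this⟩, funext fun v => (p.1 v).2⟩⟩
      left_inv := by
        rintro ⟨W, L⟩
        exact sigma_sub_ext (funext fun a => LinearMap.toMatrix'_toLin' _) _ _ (fun v => rfl)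
      right_inv := by
        rintro ⟨U, f⟩
        refine Sigma.ext rfl (heq_of_eq ?_)
        funext a
        exact Subtype.ext (Matrix.toLin'_toMatrix' _) }
  rw [Nat.card_congr e]
  let _ := Fintype.ofFinite Fam
  have : ∀ U, Finite (S U) := by
    intro U
    have : ∀ a : Q.A, Finite
      ((Fin (α (Q.src a)) → k) →ₗ[k] (Fin (α (Q.tgt a)) → k)) := fun a =>
        Module.finite_of_finite k
    exact Pi.finite
  rw [Nat.card_sigma]
  have hS : ∀ U ∈ Finset.univ, Nat.card (S U) =
      ∏ a : Q.A, Fintype.card k ^ (γ (Q.src a) * γ (Q.tgt a) +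
        (α - γ) (Q.src a) * γ (Q.tgt a) + (α - γ) (Q.src a) * (α - γ) (Q.tgt a)) := by
    intro U _
    rw [Nat.card_pi]
    refine Finset.prod_congr rfl (fun a _ => ?_)
    have hα : ∀ v, α v = γ v + (α - γ) v := fun v => by
      have h0 : γ v ≤ α v := hle v
      rw [Pi.sub_apply]; omega
    exact card_hom_preserving _ _ _ _ _ _ (by rw [Module.finrank_fin_fun]; exact hα _)
      (U (Q.src a)).2 (by rw [Module.finrank_fin_fun]; exact hα _) (U (Q.tgt a)).2
  rw [Finset.sum_congr rfl hS, Finset.sum_const, smul_eq_mul, Finset.card_univ,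
    ← Nat.card_eq_fintype_card, Nat.card_pi]

theorem repCard_eq (α : Q.V → ℕ) :
    repCard Q k α = Fintype.card k ^ (∑ a : Q.A, α (Q.src a) * α (Q.tgt a)) := by
  unfold repCard StdRep
  rw [Nat.card_pi, ← Finset.prod_pow_eq_pow_sum]
  refine Finset.prod_congr rfl (fun a _ => ?_)
  rw [Module.natCard_eq_pow_finrank (K := k), Module.finrank_matrix, Nat.card_eq_fintype_card]
  simp [mul_comm]

theorem prod_grass (α γ : Q.V → ℕ) (hle : γ ≤ α) :
    (∏ v, Nat.card {U : Submodule k (Fin (α v) → k) // Module.finrank k U = γ v}) *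
      (glCard Q k γ * glCard Q k (α - γ) * Fintype.card k ^ (∑ v, (α - γ) v * γ v)) =
      glCard Q k α := by
  unfold glCard
  rw [Nat.card_pi, Nat.card_pi, Nat.card_pi, ← Finset.prod_pow_eq_pow_sum,
    ← Finset.prod_mul_distrib, ← Finset.prod_mul_distrib, ← Finset.prod_mul_distrib]
  refine Finset.prod_congr rfl (fun v _ => ?_)
  exact card_grass_std _ _ _ (by have h0 : γ v ≤ α v := hle v; rw [Pi.sub_apply]; omega)

end QuiverCount

/-- Lemma on `∫_Δ χ_α`: for `γ ≤ α` and `β = α - γ`,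
`∑_{[M], dim M = α} |Gr_γ(M)|/a_M = q^{-⟨β,γ⟩_a} r_β(q) r_γ(q)`. -/
theorem statement6 (Q : FinQuiver) (k : Type) [Field k] [Fintype k]
    (α γ : Q.V → ℕ) (hle : γ ≤ α) :
    (∑ᶠ c : IsoClass Q k α, (grCard γ c.rep : ℚ) / (autCard c.rep : ℚ)) =
      ((Fintype.card k : ℚ) ^ (-(eulerFormN Q (α - γ) γ))) *
        rFun Q k (α - γ) * rFun Q k γ := by
  let _ := Fintype.ofFinite (StdRep Q k α)
  have hG : (glCard Q k α : ℚ) ≠ 0 := by exact_mod_cast (glCard_pos α).ne'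
  have hG1 : (glCard Q k γ : ℚ) ≠ 0 := by exact_mod_cast (glCard_pos γ).ne'
  have hG2 : (glCard Q k (α - γ) : ℚ) ≠ 0 := by exact_mod_cast (glCard_pos (α - γ)).ne'
  have hq : (Fintype.card k : ℚ) ≠ 0 := by exact_mod_cast Fintype.card_ne_zero
  have h1 := sum_classes (k := k) α γ
  rw [sum_grCard α γ hle] at h1
  have h2 := prod_grass (k := k) α γ hle
  rw [← h2] at h1 hG
  rw [Finset.prod_pow_eq_pow_sum] at h1
  simp only [Finset.sum_add_distrib] at h1
  have he : -(eulerFormN Q (α - γ) γ) =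
      ((∑ a, (α - γ) (Q.src a) * γ (Q.tgt a) : ℕ) : ℤ) - ((∑ v, (α - γ) v * γ v : ℕ) : ℤ) := by
    unfold eulerFormN eulerForm
    push_cast
    ring
  unfold rFun
  rw [he, zpow_sub₀ hq, zpow_natCast, zpow_natCast, repCard_eq, repCard_eq]
  refine mul_right_cancel₀ hG (h1.trans ?_)
  push_cast
  rw [pow_add, pow_add]
  field_simp

end HallPaper
end
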